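/- Let f ∈ H²(𝔹). Then the following are equivalent: (i) f is inner; (ii) f̃ * fᶜ = fᶜ * f̃ = 1 Σ-almost everywhere on ∂𝔹; (iii) there exists I ∈ 𝕊 such that the restrictions to ∂𝔹_I satisfy (f̃ * fᶜ)_I = (fᶜ * f̃)_I = 1 almost everywhere with respect to the induced Lebesgue measure on ∂𝔹_I. -/

import Mathlib

open MeasureTheory Filter Topology
open scoped ENNReal Classical

noncomputable section

/-! ### Basic quaternionic notions -/

instance : MeasurableSpace (Quaternion ℝ) := borel _
instance : BorelSpace (Quaternion ℝ) := ⟨rfl⟩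

/-- The 2-sphere `𝕊` of quaternionic imaginary units. -/
def USphere : Set (Quaternion ℝ) := {q | q ^ 2 = -1}

/-- The open quaternionic unit ball `𝔹`. -/
def QBall : Set (Quaternion ℝ) := {q | ‖q‖ < 1}

/-- The slice `L_I = ℝ + ℝI` through an imaginary unit `I`. -/
def sliceSet (I : Quaternion ℝ) : Set (Quaternion ℝ) :=
  {q | ∃ x y : ℝ, q = (x : Quaternion ℝ) + y • I}

/-- The point `e^{tI} = cos t + (sin t) I` of the boundary circle `∂𝔹_I`. -/
def ptOn (I : Quaternion ℝ) (t : ℝ) : Quaternion ℝ :=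
  ((Real.cos t : ℝ) : Quaternion ℝ) + Real.sin t • I

/-- Slice regularity on the unit ball: on every slice the restriction of `f` has partial
derivatives satisfying the Cauchy–Riemann equation `∂f/∂x + I ∂f/∂y = 0`. -/
def SliceRegular (f : Quaternion ℝ → Quaternion ℝ) : Prop :=
  ∀ I ∈ USphere, ∀ x y : ℝ, ((x : Quaternion ℝ) + y • I) ∈ QBall →
    ∃ fx fy : Quaternion ℝ,
      HasDerivAt (fun s : ℝ => f ((s : Quaternion ℝ) + y • I)) fx x ∧
      HasDerivAt (fun t : ℝ => f ((x : Quaternion ℝ) + t • I)) fy y ∧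
      fx + I * fy = 0

/-! ### The Hardy space `H²(𝔹)` via power series coefficients.
A slice regular function on `𝔹` is identified with its coefficient sequence
`a : ℕ → ℍ`, the function being `q ↦ ∑ qⁿ aₙ`. -/

/-- Membership in `H²(𝔹)`: square-summable coefficients. -/
def MemH2 (a : ℕ → Quaternion ℝ) : Prop := Summable (fun n => ‖a n‖ ^ 2)

/-- Evaluation of the power series `q ↦ ∑ qⁿ aₙ`. -/
def evalS (a : ℕ → Quaternion ℝ) (q : Quaternion ℝ) : Quaternion ℝ := ∑' n, q ^ n * a n

/-- The `*`-product (slice product) on coefficient sequences. -/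
def sProd (a b : ℕ → Quaternion ℝ) : ℕ → Quaternion ℝ :=
  fun n => ∑ k ∈ Finset.range (n + 1), a k * b (n - k)

/-- The regular conjugate `fᶜ`. -/
def conjS (a : ℕ → Quaternion ℝ) : ℕ → Quaternion ℝ := fun n => star (a n)

/-- The symmetrization `fˢ = f * fᶜ`. -/
def symmS (a : ℕ → Quaternion ℝ) : ℕ → Quaternion ℝ := sProd a (conjS a)

/-- The squared `H²` norm `∑ ‖aₙ‖²`. -/
def h2normSq (a : ℕ → Quaternion ℝ) : ℝ := ∑' n, ‖a n‖ ^ 2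

/-- The `H²` norm. -/
def h2norm (a : ℕ → Quaternion ℝ) : ℝ := Real.sqrt (h2normSq a)

/-- The (right) quaternionic inner product `⟨f,g⟩ = ∑ conj(bₙ) aₙ` of `H²(𝔹)`. -/
def h2inner (a b : ℕ → Quaternion ℝ) : Quaternion ℝ := ∑' n, star (b n) * a n

/-- Squared `H²`-distance of two coefficient sequences (valued in `ℝ≥0∞`). -/
def h2distSq (a b : ℕ → Quaternion ℝ) : ℝ≥0∞ := ∑' n, (‖a n - b n‖₊ : ℝ≥0∞) ^ 2

/-- The boundary value function of `f ∈ H²(𝔹)`, given by the radial limit where it exists. -/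
def bdval (a : ℕ → Quaternion ℝ) (q : Quaternion ℝ) : Quaternion ℝ :=
  if h : ∃ L, Tendsto (fun r : ℝ => evalS a ((r : Quaternion ℝ) * q)) (𝓝[<] (1 : ℝ)) (𝓝 L)
  then h.choose else 0

/-! ### The measure `Σ` on `∂𝔹` with `dΣ(e^{tI}) = dσ(I) dt`. -/

/-- The normalized area measure `σ` on the sphere `𝕊` of imaginary units
(2-dimensional Hausdorff measure, normalized so that `σ(𝕊) = 1`). -/
def sphMeasure : Measure (Quaternion ℝ) := (μH[2] USphere)⁻¹ • (μH[2]).restrict USphere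

/-- The measure `Σ` on `∂𝔹`, `dΣ(e^{tI}) = dσ(I) dt`, normalized so `Σ(∂𝔹) = 1`. -/
def SigmaBd : Measure (Quaternion ℝ) :=
  (ENNReal.ofReal (2 * Real.pi))⁻¹ •
    Measure.map (fun p : ℝ × Quaternion ℝ => ptOn p.2 p.1)
      ((volume.restrict (Set.Ico 0 (2 * Real.pi))).prod sphMeasure)

/-! ### Inner, outer, cyclic -/

/-- `f ∈ H^∞(𝔹)`: a bounded function of `H²(𝔹)`. -/
def MemHinf (a : ℕ → Quaternion ℝ) : Prop :=
  MemH2 a ∧ ∃ C : ℝ, ∀ q ∈ QBall, ‖evalS a q‖ ≤ C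

/-- The `H^∞` norm: the sup of `‖f‖` on the ball. -/
def hInfNorm (a : ℕ → Quaternion ℝ) : ℝ := sSup ((fun q => ‖evalS a q‖) '' QBall)

/-- `f` is inner: `f ∈ H^∞(𝔹)`, `‖f‖ ≤ 1` on `𝔹` and `‖f‖ = 1` `Σ`-a.e. on `∂𝔹`. -/
def IsInnerQ (a : ℕ → Quaternion ℝ) : Prop :=
  MemH2 a ∧ (∀ q ∈ QBall, ‖evalS a q‖ ≤ 1) ∧ (∀ᵐ q ∂SigmaBd, ‖bdval a q‖ = 1)

/-- `g` is outer: whenever `f ∈ H²(𝔹)` has the same boundary modulus `Σ`-a.e.,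
then `‖g‖ ≥ ‖f‖` throughout `𝔹`. -/
def IsOuterQ (g : ℕ → Quaternion ℝ) : Prop :=
  MemH2 g ∧ ∀ f, MemH2 f → (∀ᵐ q ∂SigmaBd, ‖bdval g q‖ = ‖bdval f q‖) →
    ∀ q ∈ QBall, ‖evalS f q‖ ≤ ‖evalS g q‖

/-- Quaternionic polynomials (finitely supported coefficient sequences). -/
def IsPolyQ (p : ℕ → Quaternion ℝ) : Prop := ∃ N, ∀ n > N, p n = 0

/-- Quaternionic polynomials of degree at most `n` (the space `𝒫_n`). -/
def IsPolyDeg (p : ℕ → Quaternion ℝ) (n : ℕ) : Prop := ∀ m > n, p m = 0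

/-- The coefficient sequence of the monomial `qᵏ`. -/
def qpow (k : ℕ) : ℕ → Quaternion ℝ := fun n => if n = k then 1 else 0

/-- The coefficient sequence of a constant function. -/
def constS (c : Quaternion ℝ) : ℕ → Quaternion ℝ := fun n => if n = 0 then c else 0

/-- The coefficient sequence of the constant function `1`. -/
def oneS : ℕ → Quaternion ℝ := constS 1

/-- The invariant subspace `[g]`: the `H²`-closure of `{g * p : p polynomial}`,
i.e. of the right span of `{qⁿ * g : n ≥ 0}`. -/
def InvSub (g : ℕ → Quaternion ℝ) : Set (ℕ → Quaternion ℝ) :=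
  {h | MemH2 h ∧ ∀ ε : ℝ≥0∞, 0 < ε → ∃ p, IsPolyQ p ∧ h2distSq (sProd g p) h < ε}

/-- `g` is cyclic: `[g] = H²(𝔹)`. -/
def IsCyclicQ (g : ℕ → Quaternion ℝ) : Prop :=
  MemH2 g ∧ ∀ h, MemH2 h → h ∈ InvSub g

/-! ### Bilateral (slice `L²`) series, used for boundary products -/

/-- Bilateral coefficients of `f̃(q) = f(q̄)` on `∂𝔹`: `Σ_{n ≤ 0} qⁿ a_{-n}`. -/
def tildeZ (a : ℕ → Quaternion ℝ) : ℤ → Quaternion ℝ :=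
  fun k => if k ≤ 0 then a (-k).toNat else 0

/-- Bilateral coefficients of `fᶜ` on `∂𝔹`. -/
def conjZ (a : ℕ → Quaternion ℝ) : ℤ → Quaternion ℝ :=
  fun k => if 0 ≤ k then star (a k.toNat) else 0

/-- The `*`-product of two slice `L²` functions on the boundary, on coefficients. -/
def convZ (c b : ℤ → Quaternion ℝ) : ℤ → Quaternion ℝ := fun n => ∑' k : ℤ, c k * b (n - k)

/-- Evaluation of a bilateral series `q ↦ ∑_{n ∈ ℤ} qⁿ dₙ`. -/
def evalZ (d : ℤ → Quaternion ℝ) (q : Quaternion ℝ) : Quaternion ℝ := ∑' n : ℤ, q ^ n * d n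

/-- The slice inner product `⟨qᵏ * f, f⟩_I = (1/2π)∫₀^{2π} conj(f(e^{θI})) (e^{θI})ᵏ f(e^{θI}) dθ`,
computed with boundary values; note `(qᵏ * f)(q) = qᵏ f(q)` pointwise. -/
def sliceInnerPow (a : ℕ → Quaternion ℝ) (I : Quaternion ℝ) (k : ℕ) : Quaternion ℝ :=
  (2 * Real.pi)⁻¹ •
    ∫ t in Set.Ico 0 (2 * Real.pi), star (bdval a (ptOn I t)) * ((ptOn I t) ^ k * bdval a (ptOn I t))

/-! ### Complex Hardy space `H²(𝔻)` notions (for slice restrictions) -/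

/-- Membership in the complex Hardy space `H²(𝔻)` via coefficients. -/
def CMemH2 (c : ℕ → ℂ) : Prop := Summable (fun n => ‖c n‖ ^ 2)

/-- Evaluation of a complex power series. -/
def cEval (c : ℕ → ℂ) (z : ℂ) : ℂ := ∑' n, z ^ n * c n

/-- Cauchy product of complex coefficient sequences. -/
def cConv (c d : ℕ → ℂ) : ℕ → ℂ := fun n => ∑ k ∈ Finset.range (n + 1), c k * d (n - k)

/-- Squared `H²(𝔻)` distance. -/
def cDistSq (c d : ℕ → ℂ) : ℝ≥0∞ := ∑' n, (‖c n - d n‖₊ : ℝ≥0∞) ^ 2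

/-- Radial boundary values of a complex `H²` function. -/
def cBdval (c : ℕ → ℂ) (z : ℂ) : ℂ :=
  if h : ∃ L, Tendsto (fun r : ℝ => cEval c ((r : ℂ) * z)) (𝓝[<] (1 : ℝ)) (𝓝 L)
  then h.choose else 0

/-- Lebesgue measure on the unit circle `∂𝔻` (parametrized by `θ ∈ [0, 2π)`). -/
def circleM : Measure ℂ :=
  Measure.map (fun t : ℝ => Complex.exp (t * Complex.I)) (volume.restrict (Set.Ico 0 (2 * Real.pi)))

/-- Cyclicity in `H²(𝔻)`: polynomial multiples of `c` are dense. -/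
def CIsCyclic (c : ℕ → ℂ) : Prop :=
  CMemH2 c ∧ ∀ h, CMemH2 h → ∀ ε : ℝ≥0∞, 0 < ε →
    ∃ p : ℕ → ℂ, (∃ N, ∀ n > N, p n = 0) ∧ cDistSq (cConv c p) h < ε

/-- Outerness in `H²(𝔻)` (in the sense matching Definition 2.10 of the paper). -/
def CIsOuter (c : ℕ → ℂ) : Prop :=
  CMemH2 c ∧ ∀ h, CMemH2 h →
    (∀ᵐ z ∂circleM, ‖cBdval c z‖ = ‖cBdval h z‖) →
    ∀ z ∈ Metric.ball (0 : ℂ) 1, ‖cEval h z‖ ≤ ‖cEval c z‖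

/-- Complex coordinates of a point of the slice `L_I`: if `p = x + yI` then
`sliceToC I p = x + iy`. -/
def sliceToC (I : Quaternion ℝ) (p : Quaternion ℝ) : ℂ := ⟨p.re, -(p * I).re⟩

/-- The quaternion `i`. -/
def qI : Quaternion ℝ := ⟨0, 1, 0, 0⟩

/-- The embedding of `ℂ = L_i` into the quaternions. -/
def cToQ (z : ℂ) : Quaternion ℝ := (z.re : Quaternion ℝ) + z.im • qI

/-- The imaginary unit `I_ω` identified by `ω` (any imaginary unit if `ω` is real). -/
def Iu (ω : Quaternion ℝ) : Quaternion ℝ := if ω.im = 0 then qI else ‖ω.im‖⁻¹ • ω.im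

/-! ### Optimal approximants -/

/-- `p` is an optimal approximant of degree `n` of `f^{-*}`: `p ∈ 𝒫_n` minimizes
`‖f * p - 1‖_{H²}` among all `p ∈ 𝒫_n`. -/
def IsOptApprox (a : ℕ → Quaternion ℝ) (n : ℕ) (p : ℕ → Quaternion ℝ) : Prop :=
  IsPolyDeg p n ∧ ∀ r, IsPolyDeg r n → h2distSq (sProd a p) oneS ≤ h2distSq (sProd a r) oneS

end


@[simp] theorem q1re : QuaternionAlgebra.re (1 : Quaternion ℝ) = 1 := rfl
@[simp] theorem q1i : QuaternionAlgebra.imI (1 : Quaternion ℝ) = 0 := rfl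
@[simp] theorem q1j : QuaternionAlgebra.imJ (1 : Quaternion ℝ) = 0 := rfl
@[simp] theorem q1k : QuaternionAlgebra.imK (1 : Quaternion ℝ) = 0 := rfl

theorem int_mul_const {f : ℝ → Quaternion ℝ} (hf : Continuous f) (b : Quaternion ℝ) (x y : ℝ) :
    ∫ t in x..y, f t * b = (∫ t in x..y, f t) * b :=
  ContinuousLinearMap.intervalIntegral_comp_comm ((ContinuousLinearMap.mul ℝ (Quaternion ℝ)).flip b)
    (hf.intervalIntegrable x y)

theorem inner_star_mul (p x y : Quaternion ℝ) :
    inner ℝ x (star p * y) = inner ℝ y (p * x) := by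
  simp only [Quaternion.inner_def, star_mul, star_star]
  simp [Quaternion.re_mul]
  ring

theorem us_re {I : Quaternion ℝ} (h : I ∈ USphere) :
    I.re = 0 ∧ I.imI^2 + I.imJ^2 + I.imK^2 = 1 := by
  have h' : I * I = -1 := by rw [← sq]; exact h
  have h1 := congrArg QuaternionAlgebra.re h'
  have h2 := congrArg QuaternionAlgebra.imI h'
  have h3 := congrArg QuaternionAlgebra.imJ h'
  have h4 := congrArg QuaternionAlgebra.imK h'
  simp at h1 h2 h3 h4
  have hre : I.re = 0 := by
    by_contra hne
    have e2 : I.imI = 0 := by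
      apply mul_left_cancel₀ hne; linarith
    have e3 : I.imJ = 0 := by
      apply mul_left_cancel₀ hne; linarith
    have e4 : I.imK = 0 := by
      apply mul_left_cancel₀ hne; linarith
    rw [e2, e3, e4] at h1
    nlinarith [sq_nonneg I.re]
  refine ⟨hre, ?_⟩
  rw [hre] at h1
  nlinarith

theorem us_of {I : Quaternion ℝ} (h0 : I.re = 0) (h : I.imI^2 + I.imJ^2 + I.imK^2 = 1) :
    I ∈ USphere := by
  show I ^ 2 = -1
  rw [sq]
  ext <;> simp [h0]
  · nlinarith
  · ring
  · ring
  · ring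

theorem us_mul {I : Quaternion ℝ} (h : I ∈ USphere) : I * I = -1 := by
  rw [← sq]; exact h

theorem us_norm {I : Quaternion ℝ} (h : I ∈ USphere) : ‖I‖ = 1 := by
  have h1 : ‖I‖ * ‖I‖ = 1 := by
    rw [← norm_mul, us_mul h]; simp
  nlinarith [norm_nonneg I]

theorem us_star {I : Quaternion ℝ} (h : I ∈ USphere) : star I = -I := by
  have := (us_re h).1
  ext <;> simp [this]

theorem us_neg {I : Quaternion ℝ} (h : I ∈ USphere) : -I ∈ USphere := by
  show (-I)^2 = -1
  rw [neg_sq]; exact h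

theorem pt_add {I : Quaternion ℝ} (h : I ∈ USphere) (s t : ℝ) :
    ptOn I (s + t) = ptOn I s * ptOn I t := by
  obtain ⟨h0, h1⟩ := us_re h
  unfold ptOn
  rw [Real.cos_add, Real.sin_add]
  have : (s.cos : Quaternion ℝ) = s.cos • (1 : Quaternion ℝ) := by ext <;> simp
  have h2 : (t.cos : Quaternion ℝ) = t.cos • (1 : Quaternion ℝ) := by ext <;> simp
  have h3 : ((s.cos * t.cos - s.sin * t.sin : ℝ) : Quaternion ℝ)
      = (s.cos * t.cos - s.sin * t.sin) • (1 : Quaternion ℝ) := by ext <;> simp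
  rw [this, h2, h3]
  simp only [mul_add, add_mul, smul_mul_smul_comm, us_mul h, mul_one, one_mul]
  module

theorem pt_zero (I : Quaternion ℝ) : ptOn I 0 = 1 := by simp [ptOn]

theorem pt_pow {I : Quaternion ℝ} (h : I ∈ USphere) (n : ℕ) (t : ℝ) :
    ptOn I t ^ n = ptOn I (n * t) := by
  induction n with
  | zero => simp [pt_zero]
  | succ k ih => rw [pow_succ, ih, ← pt_add h]; push_cast; ring_nf

theorem pt_neg {I : Quaternion ℝ} (h : I ∈ USphere) (t : ℝ) :
    ptOn I (-t) = star (ptOn I t) := by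
  simp [ptOn, us_star h]

theorem pt_norm {I : Quaternion ℝ} (h : I ∈ USphere) (t : ℝ) : ‖ptOn I t‖ = 1 := by
  have h1 : ‖ptOn I t‖ * ‖ptOn I t‖ = 1 := by
    have : ptOn I t * ptOn I (-t) = 1 := by rw [← pt_add h]; simp [pt_zero]
    have h2 := congrArg norm this
    rw [pt_neg h, norm_mul, norm_star, norm_one] at h2
    exact h2
  nlinarith [norm_nonneg (ptOn I t)]

theorem pt_zpow {I : Quaternion ℝ} (h : I ∈ USphere) (n : ℤ) (t : ℝ) :
    ptOn I t ^ n = ptOn I (n * t) := by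
  have hinv : ∀ s, (ptOn I s)⁻¹ = ptOn I (-s) := by
    intro s
    apply inv_eq_of_mul_eq_one_right
    rw [← pt_add h]; simp [pt_zero]
  cases n with
  | ofNat n => simp [pt_pow h]
  | negSucc n => rw [zpow_negSucc, pt_pow h, hinv]; push_cast; ring_nf

theorem pt_cont (I : Quaternion ℝ) : Continuous (ptOn I) := by
  unfold ptOn
  exact (Quaternion.continuous_coe.comp Real.continuous_cos).add
    (Real.continuous_sin.smul continuous_const)

theorem pt_eq (I : Quaternion ℝ) (t : ℝ) :
    ptOn I t = Real.cos t • (1 : Quaternion ℝ) + Real.sin t • I := by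
  unfold ptOn; congr 1; ext <;> simp

theorem pt_int (I : Quaternion ℝ) (k : ℤ) :
    ∫ t in (0:ℝ)..(2 * Real.pi), ptOn I (k * t) =
      if k = 0 then ((2 * Real.pi : ℝ)) • (1 : Quaternion ℝ) else 0 := by
  split_ifs with hk
  · subst hk; simp [pt_zero]
  · have hk' : (k : ℝ) ≠ 0 := by exact_mod_cast hk
    simp only [pt_eq]
    rw [intervalIntegral.integral_add, intervalIntegral.integral_smul_const,
      intervalIntegral.integral_smul_const,
      intervalIntegral.integral_comp_mul_left (fun x => Real.cos x) hk',
      intervalIntegral.integral_comp_mul_left (fun x => Real.sin x) hk']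
    · simp only [integral_cos, integral_sin]
      have h1 : Real.sin (k * (2 * Real.pi)) = 0 := by
        rw [Real.sin_eq_zero_iff]; exact ⟨2 * k, by push_cast; ring⟩
      have h2 : Real.cos (k * (2 * Real.pi)) = 1 := Real.cos_int_mul_two_pi k
      simp [h1, h2]
    · apply Continuous.intervalIntegrable; fun_prop
    · apply Continuous.intervalIntegrable; fun_prop

/-- slice series -/
noncomputable def ser {ι : Type} (I : Quaternion ℝ) (e : ι → ℤ) (b : ι → Quaternion ℝ) (t : ℝ) :
    Quaternion ℝ := ∑' i, ptOn I (e i * t) * b i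

theorem ser_summable {ι : Type} {I : Quaternion ℝ} (h : I ∈ USphere) (e : ι → ℤ)
    {b : ι → Quaternion ℝ} (hb : Summable fun i => ‖b i‖) (t : ℝ) :
    Summable fun i => ptOn I (e i * t) * b i := by
  apply Summable.of_norm
  simpa [pt_norm h] using hb

theorem ser_cont {ι : Type} {I : Quaternion ℝ} (h : I ∈ USphere) (e : ι → ℤ)
    {b : ι → Quaternion ℝ} (hb : Summable fun i => ‖b i‖) : Continuous (ser I e b) := by
  unfold ser
  refine continuous_tsum (fun i => ?_) hb (fun i t => ?_)
  · exact ((pt_cont I).comp (by fun_prop)).mul continuous_const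
  · simp [pt_norm h]

theorem hasSum_int {ι : Type} [Countable ι] {E : Type} [NormedAddCommGroup E] [NormedSpace ℝ E]
    [CompleteSpace E] {f : ι → ℝ → E} {u : ι → ℝ} (x y : ℝ)
    (hf : ∀ i, Continuous (f i)) (hu : Summable u) (hle : ∀ i t, ‖f i t‖ ≤ u i) :
    HasSum (fun i => ∫ t in x..y, f i t) (∫ t in x..y, ∑' i, f i t) := by
  apply intervalIntegral.hasSum_integral_of_dominated_convergence (fun i _ => u i)
  · intro i; exact (hf i).aestronglyMeasurable
  · intro i; filter_upwards with t _ using hle i t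
  · filter_upwards with t _ using hu
  · exact intervalIntegrable_const
  · filter_upwards with t _
    exact (Summable.of_norm_bounded hu (fun i => hle i t)).hasSum

theorem ser_coef {ι : Type} [Countable ι] {I : Quaternion ℝ} (h : I ∈ USphere) {e : ι → ℤ}
    (he : Function.Injective e)
    {b : ι → Quaternion ℝ} (hb : Summable fun i => ‖b i‖) (j : ι) :
    ∫ t in (0:ℝ)..(2 * Real.pi), ptOn I (-(e j * t)) * ser I e b t = (2 * Real.pi) • b j := by
  have h1 := hasSum_int (f := fun i t => ptOn I (((e i - e j : ℤ) : ℝ) * t) * b i) (u := fun i => ‖b i‖)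
    0 (2 * Real.pi) (fun i => ((pt_cont I).comp (by fun_prop)).mul continuous_const) hb
    (fun i t => by simp [pt_norm h])
  have h2 : ∀ i, ∫ t in (0:ℝ)..(2 * Real.pi), ptOn I (((e i - e j : ℤ) : ℝ) * t) * b i
      = if i = j then (2 * Real.pi) • b j else 0 := by
    intro i
    rw [int_mul_const (f := fun t => ptOn I (((e i - e j : ℤ) : ℝ) * t))
      ((pt_cont I).comp (by fun_prop)), pt_int]
    by_cases hij : i = j
    · subst hij; simp
    · have : e i - e j ≠ 0 := fun h => hij (he (sub_eq_zero.1 h))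
      simp [hij, this]
  simp only [h2] at h1
  rw [(hasSum_ite_eq j _).unique h1]
  apply intervalIntegral.integral_congr
  intro t _
  simp only [ser]
  rw [← tsum_mul_left]
  apply tsum_congr
  intro i
  rw [← mul_assoc, ← pt_add h]
  congr 2; push_cast; ring

theorem parseval {ι : Type} [Countable ι] {I : Quaternion ℝ} (h : I ∈ USphere) {e : ι → ℤ}
    (he : Function.Injective e)
    {b : ι → Quaternion ℝ} (hb : Summable fun i => ‖b i‖) :
    HasSum (fun i => 2 * Real.pi * ‖b i‖^2)
      (∫ t in (0:ℝ)..(2 * Real.pi), ‖ser I e b t‖^2) := by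
  set C := ∑' i, ‖b i‖
  have hC : ∀ t, ‖ser I e b t‖ ≤ C := by
    intro t
    refine (norm_tsum_le_tsum_norm ?_).trans ?_
    · simpa [pt_norm h] using hb
    · simp [pt_norm h, C]
  have hc := ser_cont h e hb
  have hci : ∀ i, Continuous fun t : ℝ => ptOn I (-(e i * t)) * ser I e b t := fun i =>
    ((pt_cont I).comp (by fun_prop)).mul hc
  have h1 := hasSum_int (f := fun i t => inner ℝ (b i) (ptOn I (-(e i * t)) * ser I e b t))
    (u := fun i => ‖b i‖ * C)
    0 (2 * Real.pi) (fun i => continuous_const.inner (hci i)) (hb.mul_right C) (fun i t => by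
      refine (norm_inner_le_norm _ _).trans ?_
      rw [norm_mul, pt_norm h, one_mul]
      exact mul_le_mul_of_nonneg_left (hC t) (norm_nonneg _))
  have e1 : (fun i => ∫ t in (0:ℝ)..(2 * Real.pi),
      inner ℝ (b i) (ptOn I (-(e i * t)) * ser I e b t)) = fun i => 2 * Real.pi * ‖b i‖^2 := by
    funext i
    have := ContinuousLinearMap.intervalIntegral_comp_comm (innerSL ℝ (b i))
      ((hci i).intervalIntegrable (μ := volume) 0 (2 * Real.pi))
    simp only [innerSL_apply_apply] at this
    rw [this, ser_coef h he hb i, inner_smul_right, real_inner_self_eq_norm_sq]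
  rw [e1] at h1
  have key : ∀ t : ℝ, ‖ser I e b t‖^2 =
      ∑' i, inner ℝ (b i) (ptOn I (-(e i * t)) * ser I e b t) := ?_
  · simp only [key]; exact h1
  intro t
  have hs := (ser_summable h e hb t).hasSum
  have h2 := ((innerSL ℝ (ser I e b t)).hasSum hs).tsum_eq
  have h3 : ∀ i, inner ℝ (b i) (ptOn I (-(e i * t)) * ser I e b t) =
      inner ℝ (ser I e b t) (ptOn I (e i * t) * b i) := by
    intro i
    rw [pt_neg h, inner_star_mul]
  simp only [h3]
  rw [← real_inner_self_eq_norm_sq]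
  exact h2.symm


noncomputable def SS (a : ℕ → Quaternion ℝ) (p : ℕ) : Quaternion ℝ := ∑' m, a (m + p) * star (a m)

def EE (a : ℕ → Quaternion ℝ) : Prop := ∀ p, SS a p = if p = 0 then 1 else 0

theorem SS_summable {a : ℕ → Quaternion ℝ} (ha : MemH2 a) (p : ℕ) :
    Summable fun m => a (m + p) * star (a m) := by
  have h1 : Summable fun m => ‖a (m + p)‖^2 := (summable_nat_add_iff p).2 ha
  have h2 : Summable fun m => ‖a m‖^2 := ha
  refine Summable.of_norm_bounded (h1.add h2) (fun m => ?_)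
  rw [norm_mul, norm_star]
  nlinarith [sq_nonneg (‖a (m+p)‖ - ‖a m‖), sq_nonneg (‖a (m+p)‖ + ‖a m‖)]

theorem conjS_mem {a : ℕ → Quaternion ℝ} (ha : MemH2 a) : MemH2 (conjS a) := by
  unfold MemH2 conjS; simp only [norm_star]; exact ha

theorem conjS_conjS (a : ℕ → Quaternion ℝ) : conjS (conjS a) = a := by
  funext n; simp [conjS]

theorem SS_zero {a : ℕ → Quaternion ℝ} (ha : MemH2 a) :
    SS a 0 = ((∑' n, ‖a n‖^2 : ℝ) : Quaternion ℝ) := by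
  have h2 : Summable fun m => ‖a m‖^2 := ha
  have h := h2.hasSum.map (algebraMap ℝ (Quaternion ℝ)) Quaternion.continuous_coe
  have h3 := h.tsum_eq
  unfold SS
  refine Eq.trans ?_ h3
  apply tsum_congr
  intro m
  rw [add_zero, Quaternion.self_mul_star, Quaternion.normSq_eq_norm_mul_self, ← sq]
  rfl

theorem conv_neg (a : ℕ → Quaternion ℝ) (p : ℕ) :
    convZ (tildeZ a) (conjZ a) (-(p : ℤ)) = SS a p := by
  unfold convZ SS
  have hinj : Function.Injective (fun m : ℕ => -((m : ℤ) + p)) := by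
    intro x y h; simp at h; exact h
  rw [← hinj.tsum_eq]
  · apply tsum_congr
    intro m
    simp only [tildeZ, conjZ]
    rw [if_pos (by omega), if_pos (by omega)]
    congr 2
    · congr 1; omega
    · congr 1; omega
  · intro k hk
    simp only [Function.mem_support, tildeZ, conjZ] at hk
    refine ⟨(-k - p).toNat, ?_⟩
    have h1 : k ≤ 0 := by by_contra h; simp [h] at hk
    have h2 : 0 ≤ -(p:ℤ) - k := by
      by_contra h; rw [if_neg h] at hk; simp at hk
    simp only; omega

theorem conv_pos (a : ℕ → Quaternion ℝ) (p : ℕ) :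
    convZ (tildeZ a) (conjZ a) (p : ℤ) = star (SS a p) := by
  unfold convZ SS
  rw [tsum_star]
  have hinj : Function.Injective (fun m : ℕ => -(m : ℤ)) := by
    intro x y h; simp at h; exact h
  rw [← hinj.tsum_eq]
  · apply tsum_congr
    intro m
    simp only [tildeZ, conjZ]
    rw [if_pos (by omega), if_pos (by omega), star_mul, star_star]
    congr 2
    · omega
    · congr 1; omega
  · intro k hk
    simp only [Function.mem_support, tildeZ, conjZ] at hk
    refine ⟨(-k).toNat, ?_⟩
    have h1 : k ≤ 0 := by by_contra h; simp [h] at hk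
    simp only; omega

theorem conv_swap (a : ℕ → Quaternion ℝ) (n : ℤ) :
    convZ (conjZ a) (tildeZ a) n = convZ (tildeZ (conjS a)) (conjZ (conjS a)) (-n) := by
  unfold convZ
  rw [← (Equiv.neg ℤ).tsum_eq]
  apply tsum_congr
  intro k
  simp only [Equiv.neg_apply, tildeZ, conjZ, conjS, star_star]
  congr 1
  · by_cases h : 0 ≤ -k
    · rw [if_pos h, if_pos (by omega)]
    · rw [if_neg h, if_neg (by omega)]
  · by_cases h : n - -k ≤ 0
    · rw [if_pos h, if_pos (by omega)]; congr 1; omega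
    · rw [if_neg h, if_neg (by omega)]

theorem EE_iff (a : ℕ → Quaternion ℝ) :
    EE a ↔ convZ (tildeZ a) (conjZ a) = fun n => if n = 0 then 1 else 0 := by
  constructor
  · intro h
    funext n
    obtain ⟨p, rfl | rfl⟩ := Int.eq_nat_or_neg n
    · rw [conv_pos, h]; by_cases hp : p = 0 <;> simp [hp]
    · rw [conv_neg, h]; by_cases hp : p = 0 <;> simp [hp]
  · intro h p
    rw [← conv_neg, h]
    by_cases hp : p = 0 <;> simp [hp]

theorem EE_conj_iff (a : ℕ → Quaternion ℝ) :
    EE (conjS a) ↔ convZ (conjZ a) (tildeZ a) = fun n => if n = 0 then 1 else 0 := by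
  rw [EE_iff]
  constructor
  · intro h; funext n; rw [conv_swap, h]; simp
  · intro h; funext n
    have := congrFun h (-n)
    rw [conv_swap, neg_neg] at this
    rw [this]; simp

theorem evalZ_one (q : Quaternion ℝ) : evalZ (fun n : ℤ => if n = 0 then 1 else 0) q = 1 := by
  unfold evalZ
  rw [tsum_eq_single 0]
  · simp
  · intro n hn; simp [hn]

theorem evalZ_unique {d : ℤ → Quaternion ℝ} {I : Quaternion ℝ} (hI : I ∈ USphere)
    (h : ∀ᵐ t ∂(volume.restrict (Set.Ico 0 (2 * Real.pi))), evalZ d (ptOn I t) = 1) :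
    d = fun n => if n = 0 then 1 else 0 := by
  have hev : ∀ t, evalZ d (ptOn I t) = ser I id d t := by
    intro t; unfold evalZ ser
    simp [pt_zpow hI]
  have hne : NeZero (volume.restrict (Set.Ico 0 (2 * Real.pi))) := by
    constructor
    rw [Ne, Measure.restrict_eq_zero]
    simp [Real.pi_pos]
  obtain ⟨t0, ht0⟩ := h.exists
  have hs : Summable fun n => ‖d n‖ := by
    have : Summable fun n : ℤ => ptOn I t0 ^ n * d n := by
      by_contra hns
      unfold evalZ at ht0
      rw [tsum_eq_zero_of_not_summable hns] at ht0
      exact zero_ne_one ht0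
    have := this.norm
    simpa [pt_zpow hI, pt_norm hI] using this
  funext n
  have h1 := ser_coef hI (e := id) Function.injective_id hs n
  have h2 : ∫ t in (0:ℝ)..(2 * Real.pi), ptOn I (-(id n * t)) * ser I id d t
      = ∫ t in (0:ℝ)..(2 * Real.pi), ptOn I (((-n : ℤ) : ℝ) * t) := by
    apply intervalIntegral.integral_congr_ae
    rw [restrict_Ico_eq_restrict_Ioc, ae_restrict_iff' measurableSet_Ioc] at h
    rw [Set.uIoc_of_le (by positivity)]
    filter_upwards [h] with t ht hmem
    rw [← hev, ht hmem]; simp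
  rw [h2, pt_int] at h1
  have hpi : (2 * Real.pi) ≠ 0 := by positivity
  have := congrArg (fun x => (2 * Real.pi)⁻¹ • x) h1
  simp only [smul_smul, inv_mul_cancel₀ hpi, one_smul] at this
  rw [← this]
  by_cases hn : n = 0
  · simp only [hn, neg_zero, if_true, smul_smul, inv_mul_cancel₀ hpi, one_smul]
  · simp [hn]

theorem inner_one_left (x : Quaternion ℝ) : inner ℝ (1 : Quaternion ℝ) x = x.re := by
  simp [Quaternion.inner_def]

theorem hasSum_re {f : ℕ → Quaternion ℝ} {x : Quaternion ℝ} (h : HasSum f x) :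
    HasSum (fun n => (f n).re) x.re := by
  have := (innerSL ℝ (1 : Quaternion ℝ)).hasSum h
  simpa only [innerSL_apply_apply, inner_one_left] using this

/-- shifted vectors -/
theorem V_mem {a : ℕ → Quaternion ℝ} (ha : MemH2 a) (k : ℕ) (c : Quaternion ℝ) :
    Memℓp (fun m => if k ≤ m then c * a (m - k) else 0 : ℕ → Quaternion ℝ) 2 := by
  rw [memℓp_gen_iff (by norm_num)]
  simp only [ENNReal.toReal_ofNat, Real.rpow_ofNat]
  rw [← summable_nat_add_iff k]
  simp only [le_add_iff_nonneg_left, zero_le, if_true, Nat.add_sub_cancel, norm_mul, mul_pow]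
  exact Summable.mul_left _ ha

noncomputable def VV {a : ℕ → Quaternion ℝ} (ha : MemH2 a) (k : ℕ) (c : Quaternion ℝ) :
    lp (fun _ : ℕ => Quaternion ℝ) 2 := ⟨_, V_mem ha k c⟩

theorem VV_apply {a : ℕ → Quaternion ℝ} (ha : MemH2 a) (k : ℕ) (c : Quaternion ℝ) (m : ℕ) :
    VV ha k c m = if k ≤ m then c * a (m - k) else 0 := rfl

theorem VV_inner {a : ℕ → Quaternion ℝ} (ha : MemH2 a) (l p : ℕ) (c c' : Quaternion ℝ) :
    inner ℝ (VV ha l c') (VV ha (l + p) c) = (c' * SS a p * star c).re := by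
  rw [← (lp.hasSum_inner _ _).tsum_eq]
  have hinj : Function.Injective (fun m : ℕ => m + (l + p)) := fun x y h => by simpa using h
  rw [← hinj.tsum_eq]
  · have h1 := (SS_summable ha p).hasSum
    have h2 := (h1.mul_left c').mul_right (star c)
    rw [SS, ← (hasSum_re h2).tsum_eq]
    apply tsum_congr
    intro m
    rw [VV_apply, VV_apply, if_pos (by omega), if_pos (by omega), Quaternion.inner_def, star_mul]
    rw [show m + (l + p) - l = m + p by omega, show m + (l + p) - (l + p) = m by omega]
    simp only [mul_assoc]
  · intro m hm
    simp only [Function.mem_support, VV_apply] at hm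
    refine ⟨m - (l + p), ?_⟩
    have h1 : l + p ≤ m := by by_contra h; simp [h] at hm
    simp only; omega

theorem VV_norm {a : ℕ → Quaternion ℝ} (ha : MemH2 a) (k : ℕ) (c : Quaternion ℝ) :
    ‖VV ha k c‖^2 = ‖c‖^2 * ∑' n, ‖a n‖^2 := by
  rw [← real_inner_self_eq_norm_sq]
  have := VV_inner ha k 0 c c
  rw [add_zero] at this
  rw [this, SS_zero ha, ← Quaternion.coe_commutes, mul_assoc, Quaternion.self_mul_star,
    Quaternion.normSq_eq_norm_mul_self, ← Quaternion.coe_mul, Quaternion.re_coe]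
  ring

theorem qpw_mem {q : Quaternion ℝ} (hq : ‖q‖ < 1) :
    Memℓp (fun m => q ^ m : ℕ → Quaternion ℝ) 2 := by
  rw [memℓp_gen_iff (by norm_num)]
  simp only [ENNReal.toReal_ofNat, Real.rpow_ofNat, norm_pow]
  have : Summable fun m : ℕ => (‖q‖^2)^m :=
    summable_geometric_of_lt_one (by positivity) (by nlinarith [norm_nonneg q])
  simpa only [← pow_mul, mul_comm] using this

theorem coef_bdd {a : ℕ → Quaternion ℝ} (ha : MemH2 a) (n : ℕ) :
    ‖a n‖ ^ 2 ≤ ∑' n, ‖a n‖^2 := by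
  have h : Summable fun n => ‖a n‖^2 := ha
  exact h.le_tsum n (fun _ _ => by positivity)

theorem geo_summable {a : ℕ → Quaternion ℝ} (ha : MemH2 a) {r : ℝ} (h0 : 0 ≤ r) (h1 : r < 1) :
    Summable fun n => r ^ n * ‖a n‖ := by
  set C := ∑' n, ‖a n‖^2
  have : Summable fun n : ℕ => r ^ n * (1 + C) :=
    (summable_geometric_of_lt_one h0 h1).mul_right _
  refine Summable.of_nonneg_of_le (fun n => by positivity) (fun n => ?_) this
  apply mul_le_mul_of_nonneg_left _ (by positivity)
  have := coef_bdd ha n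
  nlinarith [sq_nonneg (‖a n‖ - 1), norm_nonneg (a n)]

theorem evalS_summable {a : ℕ → Quaternion ℝ} (ha : MemH2 a) {q : Quaternion ℝ} (hq : ‖q‖ < 1) :
    Summable fun n => q ^ n * a n := by
  apply Summable.of_norm
  simpa using geo_summable ha (norm_nonneg q) hq

theorem bound_conj {a : ℕ → Quaternion ℝ} (ha : MemH2 a) (hE : EE a) {q : Quaternion ℝ}
    (hq : q ∈ QBall) : ‖evalS (conjS a) q‖ ≤ 1 := by
  have hq : ‖q‖ < 1 := hq
  have hn1 : ∑' n, ‖a n‖^2 = 1 := by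
    have := hE 0
    rw [SS_zero ha] at this
    simpa using congrArg QuaternionAlgebra.re this
  by_cases hq0 : q = 0
  · subst hq0
    have : evalS (conjS a) 0 = star (a 0) := by
      unfold evalS
      rw [tsum_eq_single 0]
      · simp [conjS]
      · intro n hn; simp [hn]
    rw [this, norm_star]
    have := coef_bdd ha 0
    rw [hn1] at this
    nlinarith [norm_nonneg (a 0)]
  set g := evalS (conjS a) q with hg
  by_cases hg0 : g = 0
  · rw [hg0]; simp
  have hk0 : ∀ k, ‖q ^ k * g‖ ≠ 0 := fun k => by
    rw [norm_ne_zero_iff]; exact mul_ne_zero (pow_ne_zero _ hq0) hg0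
  let c : ℕ → Quaternion ℝ := fun k => ‖q ^ k * g‖⁻¹ • (q ^ k * g)
  have hc : ∀ k, ‖c k‖ = 1 := by
    intro k
    simp only [c]
    rw [norm_smul, norm_inv, norm_norm, inv_mul_cancel₀ (hk0 k)]
  let v : ℕ → lp (fun _ : ℕ => Quaternion ℝ) 2 := fun k => VV ha k (c k)
  have hlt : ∀ k l, k < l → inner ℝ (v k) (v l) = 0 := by
    intro k l hkl
    obtain ⟨p, rfl⟩ := Nat.exists_eq_add_of_lt hkl
    have := VV_inner ha k (p + 1) (c (k + p + 1)) (c k)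
    rw [hE] at this
    simpa [v, add_assoc, show QuaternionAlgebra.re (0 : Quaternion ℝ) = 0 from rfl] using this
  have hv : Orthonormal ℝ v := by
    constructor
    · intro k
      have := VV_norm ha k (c k)
      rw [hc, hn1] at this
      have h2 : ‖v k‖^2 = 1 := by simpa using this
      nlinarith [norm_nonneg (v k)]
    · intro k l hkl
      rcases lt_or_gt_of_ne hkl with h | h
      · exact hlt k l h
      · rw [real_inner_comm]; exact hlt l k h
  let w : lp (fun _ : ℕ => Quaternion ℝ) 2 := ⟨_, qpw_mem hq⟩
  have hw : ∀ m, w m = q ^ m := fun m => rfl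
  have hin : ∀ k, inner ℝ (v k) w = ‖q‖^k * ‖g‖ := by
    intro k
    rw [← (lp.hasSum_inner _ _).tsum_eq]
    have hinj : Function.Injective (fun m : ℕ => m + k) := fun x y h => by simpa using h
    rw [← hinj.tsum_eq]
    · have h1 := (evalS_summable (conjS_mem ha) hq).hasSum
      have h2 := (h1.mul_left (q ^ k)).mul_right (star (c k))
      have h3 := (hasSum_re h2).tsum_eq
      have h4 : (q ^ k * g * star (c k)).re = ‖q‖^k * ‖g‖ := by
        simp only [c]
        rw [Quaternion.star_smul, mul_smul_comm, Quaternion.self_mul_star,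
          Quaternion.normSq_eq_norm_mul_self, Quaternion.re_smul, Quaternion.re_coe, smul_eq_mul,
          ← mul_assoc, inv_mul_cancel₀ (hk0 k), one_mul, norm_mul, norm_pow]
      rw [← h4, hg, evalS, ← h3]
      apply tsum_congr
      intro m
      rw [VV_apply, if_pos (by omega), hw, real_inner_comm, Quaternion.inner_def, star_mul,
        Nat.add_sub_cancel, add_comm m k, pow_add]
      simp only [mul_assoc, conjS]
    · intro m hm
      simp only [Function.mem_support, v, VV_apply] at hm
      refine ⟨m - k, ?_⟩
      have h1 : k ≤ m := by by_contra h; simp [h] at hm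
      simp only; omega
  have hb := hv.tsum_inner_products_le w
  have hW : ‖w‖^2 = ∑' m : ℕ, (‖q‖^2)^m := by
    rw [← real_inner_self_eq_norm_sq, ← (lp.hasSum_inner _ _).tsum_eq]
    apply tsum_congr
    intro m
    rw [hw, real_inner_self_eq_norm_sq, norm_pow, ← pow_mul, ← pow_mul, mul_comm]
  have hr : ‖q‖^2 < 1 := by nlinarith [norm_nonneg q]
  have e1 : ∀ k, ‖inner ℝ (v k) w‖^2 = (‖q‖^2)^k * ‖g‖^2 := by
    intro k; rw [hin, Real.norm_eq_abs, sq_abs, mul_pow, ← pow_mul, ← pow_mul, mul_comm k 2]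
  simp only [e1] at hb
  rw [tsum_mul_right, hW, tsum_geometric_of_lt_one (by positivity) hr] at hb
  have hpos : 0 < (1 - ‖q‖^2)⁻¹ := by rw [inv_pos]; linarith
  have : ‖g‖^2 ≤ 1 := by
    by_contra hcon
    push Not at hcon
    nlinarith
  nlinarith [norm_nonneg g]

theorem evalS_ser (a : ℕ → Quaternion ℝ) {I : Quaternion ℝ} (hI : I ∈ USphere) (r t : ℝ) :
    evalS a ((r : Quaternion ℝ) * ptOn I t) = ser I (fun n : ℕ => (n : ℤ)) (fun n => r ^ n • a n) t := by
  unfold evalS ser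
  apply tsum_congr
  intro n
  rw [(Quaternion.coe_commute r (ptOn I t)).mul_pow, pt_pow hI, ← Quaternion.coe_pow, mul_assoc,
    Quaternion.coe_mul_eq_smul, mul_smul_comm]
  simp

theorem mem_ball {I : Quaternion ℝ} (hI : I ∈ USphere) {r : ℝ} (h0 : 0 ≤ r) (h1 : r < 1) (t : ℝ) :
    (r : Quaternion ℝ) * ptOn I t ∈ QBall := by
  show ‖_‖ < 1
  rw [norm_mul, pt_norm hI, mul_one, Quaternion.norm_coe, Real.norm_of_nonneg h0]; exact h1


theorem parsevalS {a : ℕ → Quaternion ℝ} (ha : MemH2 a) {I : Quaternion ℝ} (hI : I ∈ USphere)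
    {r : ℝ} (h0 : 0 ≤ r) (h1 : r < 1) :
    HasSum (fun n => 2 * Real.pi * (r ^ (2 * n) * ‖a n‖^2))
      (∫ t in (0:ℝ)..(2 * Real.pi), ‖evalS a ((r : Quaternion ℝ) * ptOn I t)‖^2) := by
  have hs : Summable fun n => ‖r ^ n • a n‖ := by
    simpa [norm_smul, abs_of_nonneg h0] using geo_summable ha h0 h1
  have := parseval hI (e := fun n : ℕ => (n : ℤ)) Nat.cast_injective hs
  simp only [evalS_ser a hI]
  convert this using 3 with n
  rw [norm_smul, mul_pow, norm_pow, Real.norm_of_nonneg h0, ← pow_mul, mul_comm n 2]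

/-- coefficients of `(1 + q^p u) f(r q)` -/
noncomputable def bb (a : ℕ → Quaternion ℝ) (p : ℕ) (u : Quaternion ℝ) (r : ℝ) (n : ℕ) :
    Quaternion ℝ :=
  r ^ n • a n + if p ≤ n then r ^ (n - p) • (u * a (n - p)) else 0

theorem bb_ser {a : ℕ → Quaternion ℝ} (ha : MemH2 a) {I : Quaternion ℝ} (hI : I ∈ USphere)
    (p : ℕ) (θ : ℝ) {r : ℝ} (h0 : 0 ≤ r) (h1 : r < 1) (t : ℝ) :
    HasSum (fun n : ℕ => ptOn I (((n : ℤ) : ℝ) * t) * bb a p (ptOn I θ) r n)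
      ((1 + ptOn I (p * t + θ)) * evalS a ((r : Quaternion ℝ) * ptOn I t)) := by
  have hs : Summable fun n => ‖r ^ n • a n‖ := by
    simpa [norm_smul, abs_of_nonneg h0] using geo_summable ha h0 h1
  have hF := (ser_summable hI (fun n : ℕ => (n : ℤ)) hs t).hasSum
  rw [add_mul, one_mul, evalS_ser a hI]
  unfold bb
  simp only [mul_add]
  apply HasSum.add hF
  have h2 := hF.mul_left (ptOn I (p * t + θ))
  have hinj : Function.Injective (fun m : ℕ => m + p) := fun x y h => by simpa using h
  rw [← hinj.hasSum_iff]
  · refine Eq.mp (congrArg (fun f => HasSum f _) (funext fun m => ?_)) h2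
    symm
    simp only [Function.comp, le_add_iff_nonneg_left, zero_le, if_true, Nat.add_sub_cancel]
    rw [mul_smul_comm, mul_smul_comm, mul_smul_comm, ← mul_assoc, ← mul_assoc, ← pt_add hI,
      ← pt_add hI]
    congr 3
    push_cast; ring
  · intro n hn
    have : ¬ p ≤ n := fun h => hn ⟨n - p, by simp; omega⟩
    simp [this]

theorem bb_norm {a : ℕ → Quaternion ℝ} (ha : MemH2 a) {u : Quaternion ℝ} (hu : ‖u‖ = 1)
    (p : ℕ) {r : ℝ} (h0 : 0 ≤ r) (h1 : r < 1) : Summable fun n => ‖bb a p u r n‖ := by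
  have hs : Summable fun n => ‖r ^ n • a n‖ := by
    simpa [norm_smul, abs_of_nonneg h0] using geo_summable ha h0 h1
  have h2 : Summable fun n => ‖(if p ≤ n then r ^ (n - p) • (u * a (n - p)) else 0 : Quaternion ℝ)‖ := by
    rw [← summable_nat_add_iff p]
    refine hs.congr (fun m => ?_)
    simp [norm_smul, hu]
  exact Summable.of_nonneg_of_le (fun n => norm_nonneg _) (fun n => norm_add_le _ _) (hs.add h2)

theorem int_one_add {I : Quaternion ℝ} (hI : I ∈ USphere) {p : ℕ} (hp : p ≠ 0) (θ : ℝ) :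
    ∫ t in (0:ℝ)..(2 * Real.pi), ‖1 + ptOn I (p * t + θ)‖^2 = 4 * Real.pi := by
  have hp' : (p : ℝ) ≠ 0 := by exact_mod_cast hp
  have h1 : ∀ t : ℝ, ‖1 + ptOn I (p * t + θ)‖^2 = 2 + 2 * Real.cos (p * t + θ) := by
    intro t
    rw [norm_add_sq_real, pt_norm hI, inner_one_left, norm_one]
    simp [ptOn, (us_re hI).1]
    ring
  simp only [h1]
  rw [intervalIntegral.integral_add (by simp) (by apply Continuous.intervalIntegrable; fun_prop),
    intervalIntegral.integral_const_mul,
    intervalIntegral.integral_comp_mul_add (fun x => Real.cos x) hp']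
  have : Real.sin (p * (2 * Real.pi) + θ) = Real.sin θ := by
    rw [add_comm]; exact Real.sin_add_nat_mul_two_pi θ p
  simp [this]
  ring

theorem bb_le {a : ℕ → Quaternion ℝ} (ha : MemH2 a) (hb : ∀ q ∈ QBall, ‖evalS a q‖ ≤ 1)
    {I : Quaternion ℝ} (hI : I ∈ USphere)
    {p : ℕ} (hp : p ≠ 0) (θ : ℝ) {r : ℝ} (h0 : 0 ≤ r) (h1 : r < 1) (s : Finset ℕ) :
    ∑ n ∈ s, ‖bb a p (ptOn I θ) r n‖^2 ≤ 2 := by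
  have hs := bb_norm ha (pt_norm hI θ) p h0 h1
  have hP := parseval hI (e := fun n : ℕ => (n : ℤ)) Nat.cast_injective hs
  have h2 := sum_le_hasSum s (fun i _ => by positivity) hP
  have h3 : ∫ t in (0:ℝ)..(2 * Real.pi), ‖ser I (fun n : ℕ => (n : ℤ)) (bb a p (ptOn I θ) r) t‖^2
      ≤ 4 * Real.pi := by
    rw [← int_one_add hI hp θ]
    apply intervalIntegral.integral_mono_on (by positivity)
    · apply Continuous.intervalIntegrable
      exact (ser_cont hI _ hs).norm.pow 2
    · apply Continuous.intervalIntegrable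
      exact (continuous_const.add ((pt_cont I).comp (by fun_prop))).norm.pow 2
    · intro t _
      rw [ser, (bb_ser ha hI p θ h0 h1 t).tsum_eq, norm_mul]
      have := hb _ (mem_ball hI h0 h1 t)
      apply pow_le_pow_left₀ (by positivity)
      exact mul_le_of_le_one_right (norm_nonneg _) this
  rw [← Finset.mul_sum] at h2
  have := Real.pi_pos
  nlinarith

theorem inner_le {a : ℕ → Quaternion ℝ} (ha : MemH2 a) (hb : ∀ q ∈ QBall, ‖evalS a q‖ ≤ 1)
    (hn : ∑' n, ‖a n‖^2 = 1) {I : Quaternion ℝ} (hI : I ∈ USphere)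
    {p : ℕ} (hp : p ≠ 0) (θ : ℝ) : (SS a p * star (ptOn I θ)).re ≤ 0 := by
  set X := VV ha 0 1
  set Y := VV ha (0 + p) (ptOn I θ)
  have hX : ‖X‖^2 = 1 := by rw [VV_norm, hn]; simp
  have hY : ‖Y‖^2 = 1 := by rw [VV_norm, hn, pt_norm hI]; simp
  have hXY : inner ℝ X Y = (SS a p * star (ptOn I θ)).re := by
    rw [VV_inner, one_mul]
  have hsum : ‖X + Y‖^2 ≤ 2 := by
    rw [← real_inner_self_eq_norm_sq]
    have hS := lp.hasSum_inner (𝕜 := ℝ) (X + Y) (X + Y)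
    refine hasSum_le_of_sum_le hS (fun s => ?_)
    have h1 : ∀ᶠ r in 𝓝[<] (1:ℝ), ∑ n ∈ s, ‖bb a p (ptOn I θ) r n‖^2 ≤ 2 := by
      filter_upwards [Ioo_mem_nhdsLT (show (0:ℝ) < 1 by norm_num)] with r hr
      exact bb_le ha hb hI hp θ hr.1.le hr.2 s
    have hc : Continuous fun r => ∑ n ∈ s, ‖bb a p (ptOn I θ) r n‖^2 := by
      refine continuous_finsetSum _ (fun n _ => ?_)
      unfold bb
      split_ifs <;> fun_prop
    have h2 : Tendsto (fun r => ∑ n ∈ s, ‖bb a p (ptOn I θ) r n‖^2) (𝓝[<] (1:ℝ))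
        (𝓝 (∑ n ∈ s, ‖bb a p (ptOn I θ) 1 n‖^2)) := hc.continuousAt.tendsto.mono_left nhdsWithin_le_nhds
    have h3 := le_of_tendsto h2 h1
    refine le_of_eq_of_le ?_ h3
    apply Finset.sum_congr rfl
    intro n _
    rw [real_inner_self_eq_norm_sq, lp.coeFn_add, Pi.add_apply, VV_apply, VV_apply]
    simp [bb]
  rw [norm_add_sq_real, hX, hY, hXY] at hsum
  linarith

noncomputable def qi : Quaternion ℝ := ⟨0,1,0,0⟩
@[simp] theorem qi_re : qi.re = 0 := rfl
@[simp] theorem qi_imI : qi.imI = 1 := rfl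
@[simp] theorem qi_imJ : qi.imJ = 0 := rfl
@[simp] theorem qi_imK : qi.imK = 0 := rfl
theorem qi_us : qi ∈ USphere := us_of (by simp) (by simp)
noncomputable def qj : Quaternion ℝ := ⟨0,0,1,0⟩
@[simp] theorem qj_re : qj.re = 0 := rfl
@[simp] theorem qj_imI : qj.imI = 0 := rfl
@[simp] theorem qj_imJ : qj.imJ = 1 := rfl
@[simp] theorem qj_imK : qj.imK = 0 := rfl
theorem qj_us : qj ∈ USphere := us_of (by simp) (by simp)
noncomputable def qk : Quaternion ℝ := ⟨0,0,0,1⟩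
@[simp] theorem qk_re : qk.re = 0 := rfl
@[simp] theorem qk_imI : qk.imI = 0 := rfl
@[simp] theorem qk_imJ : qk.imJ = 0 := rfl
@[simp] theorem qk_imK : qk.imK = 1 := rfl
theorem qk_us : qk ∈ USphere := us_of (by simp) (by simp)

theorem EE_of_bound {a : ℕ → Quaternion ℝ} (ha : MemH2 a) (hb : ∀ q ∈ QBall, ‖evalS a q‖ ≤ 1)
    (hn : ∑' n, ‖a n‖^2 = 1) : EE a := by
  intro p
  by_cases hp : p = 0
  · subst hp; rw [SS_zero ha, hn]; simp
  rw [if_neg hp]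
  have hle := fun {I} (hI : I ∈ USphere) θ => inner_le ha hb hn hI hp θ
  have e1 := hle qi_us 0
  have e2 := hle qi_us Real.pi
  have i1 := hle qi_us (Real.pi / 2)
  have i2 := hle qi_us (-(Real.pi / 2))
  have j1 := hle qj_us (Real.pi / 2)
  have j2 := hle qj_us (-(Real.pi / 2))
  have k1 := hle qk_us (Real.pi / 2)
  have k2 := hle qk_us (-(Real.pi / 2))
  simp [ptOn, Quaternion.re_mul] at e1 e2 i1 i2 j1 j2 k1 k2
  apply Quaternion.ext
  · show _ = (0:ℝ); linarith
  · show _ = (0:ℝ); linarith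
  · show _ = (0:ℝ); linarith
  · show _ = (0:ℝ); linarith


noncomputable def KK (ρ s : ℝ) : ℝ :=
  2 * ρ * (1 - ρ ^ 2) * Real.sin s / (1 - 2 * ρ * Real.cos s + ρ ^ 2) ^ 2

theorem KK_den {ρ : ℝ} (h0 : 0 ≤ ρ) (h1 : ρ < 1) (s : ℝ) : 0 < 1 - 2 * ρ * Real.cos s + ρ ^ 2 := by
  have := Real.cos_le_one s
  nlinarith [mul_le_mul_of_nonneg_left this h0, pow_pos (sub_pos.2 h1) 2]

theorem KK_cont {ρ : ℝ} (h0 : 0 ≤ ρ) (h1 : ρ < 1) : Continuous (KK ρ) := by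
  unfold KK
  refine Continuous.div (by fun_prop) (by fun_prop) (fun s => ?_)
  exact pow_ne_zero _ (KK_den h0 h1 s).ne'

theorem KK_hasSum {ρ : ℝ} (h0 : 0 ≤ ρ) (h1 : ρ < 1) (s : ℝ) :
    HasSum (fun n : ℕ => 2 * (n * ρ ^ n) * Real.sin (n * s)) (KK ρ s) := by
  set z : ℂ := ρ * Complex.exp (s * Complex.I)
  have hz : ‖z‖ < 1 := by
    simp only [z, norm_mul, Complex.norm_exp_ofReal_mul_I, mul_one]
    simpa [abs_of_nonneg h0] using h1
  have h := hasSum_coe_mul_geometric_of_norm_lt_one hz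
  have h2 := (Complex.hasSum_im h).mul_left 2
  have hzn : ∀ n : ℕ, ((n : ℂ) * z ^ n).im = n * ρ ^ n * Real.sin (n * s) := by
    intro n
    have : (n : ℂ) * z ^ n = ((n * ρ ^ n : ℝ) : ℂ) * Complex.exp ((n * s : ℝ) * Complex.I) := by
      simp only [z, mul_pow]
      rw [← Complex.exp_nat_mul]
      push_cast; ring_nf
    rw [this, Complex.im_ofReal_mul, Complex.exp_ofReal_mul_I_im]
  simp only [hzn] at h2
  have hv : 2 * (z / (1 - z) ^ 2).im = KK ρ s := by
    have hre : z.re = ρ * Real.cos s := by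
      simp only [z]; rw [Complex.re_ofReal_mul, Complex.exp_ofReal_mul_I_re]
    have him : z.im = ρ * Real.sin s := by
      simp only [z]; rw [Complex.im_ofReal_mul, Complex.exp_ofReal_mul_I_im]
    have hD := (KK_den h0 h1 s).ne'
    have hns : Complex.normSq ((1 - z) ^ 2) = (1 - 2 * ρ * Real.cos s + ρ ^ 2) ^ 2 := by
      rw [map_pow, Complex.normSq_apply]
      simp only [Complex.sub_re, Complex.sub_im, Complex.one_re, Complex.one_im, hre, him]
      congr 1
      linear_combination (ρ ^ 2) * Real.sin_sq_add_cos_sq s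
    rw [Complex.div_im, hns, KK]
    have hre2 : ((1 - z) ^ 2).re = (1 - ρ * Real.cos s)^2 - (ρ * Real.sin s)^2 := by
      rw [sq (1 - z)]
      simp [hre, him]; ring
    have him2 : ((1 - z) ^ 2).im = -2 * (1 - ρ * Real.cos s) * (ρ * Real.sin s) := by
      rw [sq (1 - z)]
      simp [hre, him]; ring
    rw [hre2, him2, hre, him]
    field_simp
    linear_combination (-ρ ^ 3 * Real.sin s) * Real.sin_sq_add_cos_sq s
  rw [hv] at h2
  simpa [mul_assoc] using h2

theorem KK_summable {ρ : ℝ} (h0 : 0 ≤ ρ) (h1 : ρ < 1) :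
    Summable (fun n : ℕ => 2 * (n * ρ ^ n)) := by
  have := (hasSum_coe_mul_geometric_of_norm_lt_one (𝕜 := ℝ) (r := ρ) (by simpa [abs_of_nonneg h0] using h1)).summable
  exact this.mul_left 2

theorem KK_int {E : Type} [NormedAddCommGroup E] [NormedSpace ℝ E] [CompleteSpace E]
    {ρ : ℝ} (h0 : 0 ≤ ρ) (h1 : ρ < 1) {g : ℝ → E} (hg : Continuous g) :
    HasSum (fun n : ℕ => (2 * (n * ρ ^ n)) • ∫ s in (-Real.pi)..Real.pi, Real.sin (n * s) • g s)
      (∫ s in (-Real.pi)..Real.pi, KK ρ s • g s) := by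
  obtain ⟨C, hC⟩ := (isCompact_Icc (a := -Real.pi) (b := Real.pi)).exists_bound_of_continuousOn
    hg.continuousOn
  have := intervalIntegral.hasSum_integral_of_dominated_convergence (μ := volume)
    (a := -Real.pi) (b := Real.pi) (F := fun (n : ℕ) s => (2 * (n * ρ ^ n) * Real.sin (n * s)) • g s)
    (f := fun s => KK ρ s • g s)
    (fun (n : ℕ) _ => (2 * (n * ρ ^ n)) * C)
    (fun n => by apply Continuous.aestronglyMeasurable; fun_prop)
    (fun n => by
      filter_upwards with t ht
      rw [Set.uIoc_of_le (by linarith [Real.pi_pos])] at ht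
      rw [norm_smul, norm_mul]
      have e1 := Real.abs_sin_le_one (n * t)
      have e2 := hC t ⟨ht.1.le, ht.2⟩
      rw [Real.norm_of_nonneg (by positivity : (0:ℝ) ≤ 2 * (n * ρ ^ n)), mul_assoc]
      apply mul_le_mul_of_nonneg_left _ (by positivity)
      calc _ ≤ 1 * C := by
            apply mul_le_mul e1 e2 (norm_nonneg _) (by positivity)
        _ = C := one_mul C)
    (by filter_upwards with t _ using (KK_summable h0 h1).mul_right C)
    intervalIntegrable_const
    (by filter_upwards with t _ using (KK_hasSum h0 h1 t).smul_const (g t))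
  simpa only [mul_smul, intervalIntegral.integral_smul] using this

theorem int_s_sin (n : ℕ) : (n : ℝ) * ∫ s in (-Real.pi)..Real.pi, Real.sin (n * s) * s =
    if n = 0 then 0 else -2 * Real.pi * (-1) ^ n := by
  split_ifs with h
  · simp [h]
  have hn : (n : ℝ) ≠ 0 := by exact_mod_cast h
  have hd : ∀ s ∈ Set.uIcc (-Real.pi) Real.pi, HasDerivAt
      (fun s : ℝ => -(s * Real.cos (n * s)) / n + Real.sin (n * s) / n ^ 2)
      (Real.sin (n * s) * s) s := by
    intro s _
    have h1 : HasDerivAt (fun s : ℝ => (n : ℝ) * s) n s := by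
      simpa using (hasDerivAt_id s).const_mul (n : ℝ)
    have := ((((hasDerivAt_id s).mul h1.cos).neg).div_const (n : ℝ)).add (h1.sin.div_const ((n : ℝ) ^ 2))
    convert! this using 1
    simp only [id]
    field_simp
    ring
  rw [intervalIntegral.integral_eq_sub_of_hasDerivAt hd
    (by apply Continuous.intervalIntegrable; fun_prop)]
  simp only [mul_neg, Real.cos_neg, Real.sin_neg, Real.cos_nat_mul_pi, Real.sin_nat_mul_pi]
  field_simp
  ring

theorem KK_int_s {ρ : ℝ} (h0 : 0 ≤ ρ) (h1 : ρ < 1) :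
    ∫ s in (-Real.pi)..Real.pi, KK ρ s * s = 4 * Real.pi * ρ / (1 + ρ) := by
  have h := KK_int h0 h1 (g := fun s : ℝ => s) continuous_id
  simp only [smul_eq_mul] at h
  have e : (fun n : ℕ => 2 * (n * ρ ^ n) * ∫ s in (-Real.pi)..Real.pi, Real.sin (n * s) * s)
      = fun n : ℕ => (if n = 0 then 4 * Real.pi else 0) + (-4 * Real.pi) * (-ρ) ^ n := by
    funext n
    have := int_s_sin n
    calc _ = 2 * ρ ^ n * (n * ∫ s in (-Real.pi)..Real.pi, Real.sin (n * s) * s) := by ring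
      _ = _ := by
        rw [this]
        split_ifs with hn
        · subst hn; ring
        · rw [neg_pow ρ]; ring
  rw [e] at h
  have h3 : HasSum (fun n : ℕ => (if n = 0 then 4 * Real.pi else 0) + (-4 * Real.pi) * (-ρ) ^ n)
      (4 * Real.pi + (-4 * Real.pi) * (1 - (-ρ))⁻¹) := by
    have g1 : HasSum (fun n : ℕ => if n = 0 then 4 * Real.pi else 0) (4 * Real.pi) := by
      have := hasSum_single (f := fun n : ℕ => if n = 0 then 4 * Real.pi else 0) 0
        (fun b hb => if_neg hb)
      rwa [if_pos rfl] at this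
    have g2 : HasSum (fun n : ℕ => (-ρ) ^ n) (1 - (-ρ))⁻¹ :=
      hasSum_geometric_of_norm_lt_one (by rw [norm_neg, Real.norm_of_nonneg h0]; exact h1)
    exact g1.add (g2.mul_left _)
  rw [h.unique h3]
  have : (1 + ρ) ≠ 0 := by positivity
  rw [sub_neg_eq_add]
  field_simp
  ring

theorem KK_int_zero (ρ : ℝ) : ∫ s in (-Real.pi)..Real.pi, KK ρ s = 0 := by
  have := intervalIntegral.integral_comp_neg (a := -Real.pi) (b := Real.pi) (KK ρ)
  have h2 : ∀ s, KK ρ (-s) = - KK ρ s := by intro s; simp [KK, neg_div]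
  simp only [h2, intervalIntegral.integral_neg, neg_neg] at this
  linarith

theorem KK_nonneg {ρ : ℝ} (h0 : 0 ≤ ρ) (h1 : ρ < 1) {s : ℝ} (hs : s ∈ Set.Icc (-Real.pi) Real.pi) :
    0 ≤ KK ρ s * s := by
  have h : 0 ≤ Real.sin s * s := by
    rcases le_total 0 s with h | h
    · exact mul_nonneg (Real.sin_nonneg_of_nonneg_of_le_pi h hs.2) h
    · exact mul_nonneg_of_nonpos_of_nonpos (Real.sin_nonpos_of_nonpos_of_neg_pi_le h hs.1) h
  have e : KK ρ s * s = 2 * ρ * (1 - ρ ^ 2) / (1 - 2 * ρ * Real.cos s + ρ ^ 2) ^ 2 * (Real.sin s * s) := by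
    rw [KK]; ring
  rw [e]
  have : 0 ≤ 1 - ρ ^ 2 := by nlinarith
  positivity

theorem KK_small {δ : ℝ} (h0δ : 0 < δ) {ρ : ℝ} (h0 : 1/2 ≤ ρ) (h1 : ρ < 1) {s : ℝ}
    (hs : s ∈ Set.Icc (-Real.pi) Real.pi) (hd : δ ≤ |s|) :
    KK ρ s * s ≤ 2 * Real.pi * (1 - ρ ^ 2) / (1 - Real.cos δ) ^ 2 := by
  have hsp : |s| ≤ Real.pi := abs_le.2 hs
  have hc : Real.cos s ≤ Real.cos δ := by
    rw [← Real.cos_abs s]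
    exact Real.cos_le_cos_of_nonneg_of_le_pi h0δ.le hsp hd
  have hκ : 0 < 1 - Real.cos δ := by
    have : Real.cos δ < Real.cos 0 := Real.cos_lt_cos_of_nonneg_of_le_pi le_rfl (hd.trans hsp) h0δ
    rw [Real.cos_zero] at this; linarith
  have hD : 1 - Real.cos δ ≤ 1 - 2 * ρ * Real.cos s + ρ ^ 2 := by
    have := Real.cos_le_one s
    nlinarith [mul_nonneg (sub_nonneg.2 h0) (sub_nonneg.2 this)]
  have e : KK ρ s * s = 2 * ρ * (1 - ρ ^ 2) * (Real.sin s * s) / (1 - 2 * ρ * Real.cos s + ρ ^ 2) ^ 2 := by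
    rw [KK]; ring
  have hss : Real.sin s * s ≤ Real.pi := by
    calc _ ≤ |Real.sin s * s| := le_abs_self _
      _ = |Real.sin s| * |s| := abs_mul _ _
      _ ≤ 1 * Real.pi := mul_le_mul (Real.abs_sin_le_one s) hsp (abs_nonneg _) (by norm_num)
      _ = _ := one_mul _
  have hr : 0 ≤ 1 - ρ ^ 2 := by nlinarith
  rw [e]
  apply div_le_div₀
  · have := Real.pi_pos; positivity
  · calc 2 * ρ * (1 - ρ ^ 2) * (Real.sin s * s) ≤ 2 * ρ * (1 - ρ ^ 2) * Real.pi :=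
          mul_le_mul_of_nonneg_left hss (by positivity)
      _ ≤ 2 * 1 * (1 - ρ ^ 2) * Real.pi := by
          have := Real.pi_pos
          gcongr
      _ = _ := by ring
  · positivity
  · gcongr


theorem pt_comm (I : Quaternion ℝ) (t : ℝ) : I * ptOn I t = ptOn I t * I := by
  rw [pt_eq]; simp [mul_add, add_mul]

theorem pt_int' {I : Quaternion ℝ} (k : ℤ) :
    ∫ t in (-Real.pi)..Real.pi, ptOn I (k * t) =
      if k = 0 then ((2 * Real.pi : ℝ)) • (1 : Quaternion ℝ) else 0 := by
  rw [← pt_int]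
  have hp : Function.Periodic (fun t : ℝ => ptOn I (k * t)) (2 * Real.pi) := by
    intro t
    simp only [ptOn]
    rw [mul_add, Real.cos_add_int_mul_two_pi, Real.sin_add_int_mul_two_pi]
  have := hp.intervalIntegral_add_eq (-Real.pi) 0
  simp only [zero_add] at this
  rw [← this]
  congr 1; ring

theorem sin_pt {I : Quaternion ℝ} (hI : I ∈ USphere) (m n : ℤ) (s : ℝ) :
    Real.sin (m * s) • ptOn I (n * s) =
      ((-(1/2) : ℝ) • I) * (ptOn I (((n + m : ℤ) : ℝ) * s) - ptOn I (((n - m : ℤ) : ℝ) * s)) := by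
  have e1 : ((n + m : ℤ) : ℝ) * s = m * s + n * s := by push_cast; ring
  have e2 : ((n - m : ℤ) : ℝ) * s = -(m * s) + n * s := by push_cast; ring
  rw [e1, e2, pt_add hI, pt_add hI, ← sub_mul, ← mul_assoc, pt_eq I (m * s), pt_eq I (-(m * s))]
  simp only [Real.cos_neg, Real.sin_neg]
  have : (((-(1/2) : ℝ) • I) * (Real.cos (m * s) • (1 : Quaternion ℝ) + Real.sin (m * s) • I -
      (Real.cos (m * s) • (1 : Quaternion ℝ) + -Real.sin (m * s) • I))) = Real.sin (m * s) • 1 := by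
    have h2 : (Real.cos (m * s) • (1 : Quaternion ℝ) + Real.sin (m * s) • I -
      (Real.cos (m * s) • (1 : Quaternion ℝ) + -Real.sin (m * s) • I)) = (2 * Real.sin (m * s)) • I := by
      module
    rw [h2, smul_mul_smul_comm, us_mul hI]
    module
  rw [this, smul_mul_assoc, one_mul]

theorem int_sin_pt {I : Quaternion ℝ} (hI : I ∈ USphere) (m n : ℕ) (hm : m ≠ 0) :
    ∫ s in (-Real.pi)..Real.pi, Real.sin (m * s) • ptOn I (n * s) =
      if n = m then Real.pi • I else 0 := by
  have h := sin_pt hI m n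
  simp only [Int.cast_natCast] at h
  simp only [h]
  have hc : ∀ k : ℤ, IntervalIntegrable (fun s : ℝ => ptOn I (k * s)) volume (-Real.pi) Real.pi :=
    fun k => ((pt_cont I).comp (by fun_prop)).intervalIntegrable _ _
  have e := ContinuousLinearMap.intervalIntegral_comp_comm
    (ContinuousLinearMap.mul ℝ (Quaternion ℝ) ((-(1/2) : ℝ) • I)) ((hc (n + m)).sub (hc (n - m)))
  simp only [ContinuousLinearMap.mul_apply'] at e
  rw [e, intervalIntegral.integral_sub (hc _) (hc _), pt_int', pt_int']
  have h1 : ((n : ℤ) + m) ≠ 0 := by omega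
  rw [if_neg h1]
  by_cases hnm : n = m
  · subst hnm
    simp only [sub_self, if_true, zero_sub]
    rw [mul_neg, mul_smul_comm, mul_one]
    module
  · have : (n : ℤ) - m ≠ 0 := by omega
    rw [if_neg this, if_neg hnm]; simp

noncomputable def cc (a : ℕ → Quaternion ℝ) (I : Quaternion ℝ) (n : ℕ) : Quaternion ℝ :=
  (n : ℝ)⁻¹ • (-(I * a n))

theorem cc_norm (a : ℕ → Quaternion ℝ) {I : Quaternion ℝ} (hI : I ∈ USphere) (n : ℕ) :
    ‖cc a I n‖ = (n : ℝ)⁻¹ * ‖a n‖ := by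
  rw [cc, norm_smul, norm_neg, norm_mul, us_norm hI, one_mul]
  simp

theorem cc_summable {a : ℕ → Quaternion ℝ} (ha : MemH2 a) {I : Quaternion ℝ} (hI : I ∈ USphere) :
    Summable fun n => ‖cc a I n‖ := by
  have h2 : Summable fun n : ℕ => ((n : ℝ) ^ 2)⁻¹ := Real.summable_nat_pow_inv.2 (by norm_num)
  refine Summable.of_nonneg_of_le (fun n => norm_nonneg _) (fun n => ?_) (h2.add ha)
  rw [cc_norm a hI, ← inv_pow]
  nlinarith [sq_nonneg ((n : ℝ)⁻¹ - ‖a n‖), sq_nonneg ((n : ℝ)⁻¹), sq_nonneg ‖a n‖]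

noncomputable def HH (a : ℕ → Quaternion ℝ) (I : Quaternion ℝ) (t : ℝ) : Quaternion ℝ :=
  ser I (fun n : ℕ => (n : ℤ)) (cc a I) t

theorem HH_cont {a : ℕ → Quaternion ℝ} (ha : MemH2 a) {I : Quaternion ℝ} (hI : I ∈ USphere) :
    Continuous (HH a I) := ser_cont hI _ (cc_summable ha hI)

theorem int_sin_HH {a : ℕ → Quaternion ℝ} (ha : MemH2 a) {I : Quaternion ℝ} (hI : I ∈ USphere)
    (t : ℝ) (m : ℕ) (hm : m ≠ 0) :
    ∫ s in (-Real.pi)..Real.pi, Real.sin (m * s) • HH a I (t + s) =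
      Real.pi • (I * (ptOn I (m * t) * cc a I m)) := by
  have h1 := hasSum_int (f := fun (n : ℕ) s => Real.sin (m * s) • (ptOn I (n * (t + s)) * cc a I n))
    (u := fun i => ‖cc a I i‖) (-Real.pi) Real.pi
    (fun i => by
      exact Continuous.fun_smul (f := fun s : ℝ => Real.sin (m * s)) (by fun_prop)
        (((pt_cont I).comp (by fun_prop)).mul continuous_const)) (cc_summable ha hI)
    (fun i s => by
      rw [norm_smul, norm_mul, pt_norm hI, one_mul]
      exact mul_le_of_le_one_left (norm_nonneg _) (Real.abs_sin_le_one _))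
  have h2 : ∀ n : ℕ, ∫ s in (-Real.pi)..Real.pi,
      Real.sin (m * s) • (ptOn I (n * (t + s)) * cc a I n) =
      if n = m then Real.pi • (I * (ptOn I (m * t) * cc a I m)) else 0 := by
    intro n
    have e : ∀ s : ℝ, Real.sin (m * s) • (ptOn I (n * (t + s)) * cc a I n) =
      (Real.sin (m * s) • ptOn I (n * s)) * (ptOn I (n * t) * cc a I n) := by
      intro s
      rw [show (n : ℝ) * (t + s) = n * s + n * t by ring, pt_add hI, smul_mul_assoc, mul_assoc]
    simp only [e]
    rw [int_mul_const (f := fun s : ℝ => Real.sin (m * s) • ptOn I (n * s))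
      (Continuous.fun_smul (f := fun s : ℝ => Real.sin (m * s)) (by fun_prop)
        ((pt_cont I).comp (by fun_prop))),
      int_sin_pt hI m n hm]
    split_ifs with h
    · subst h; rw [smul_mul_assoc]
    · simp
  simp only [h2] at h1
  rw [(hasSum_ite_eq m _).unique h1]
  apply intervalIntegral.integral_congr
  intro s _
  simp only [HH, ser]
  rw [← (ser_summable hI (fun n : ℕ => (n : ℤ)) (cc_summable ha hI) (t + s)).tsum_const_smul]
  simp

theorem cc_mul (a : ℕ → Quaternion ℝ) {I : Quaternion ℝ} (hI : I ∈ USphere) (n : ℕ) (hn : n ≠ 0) (t : ℝ) :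
    (n : ℝ) • (I * (ptOn I t * cc a I n)) = ptOn I t * a n := by
  have hn' : (n : ℝ) ≠ 0 := by exact_mod_cast hn
  rw [cc, mul_smul_comm, mul_smul_comm, smul_smul, mul_inv_cancel₀ hn', one_smul, ← mul_assoc,
    pt_comm, mul_assoc, mul_neg, ← mul_assoc, us_mul hI]
  simp

theorem HH_rep {a : ℕ → Quaternion ℝ} (ha : MemH2 a) {I : Quaternion ℝ} (hI : I ∈ USphere)
    {ρ : ℝ} (h0 : 0 ≤ ρ) (h1 : ρ < 1) (t : ℝ) :
    ∫ s in (-Real.pi)..Real.pi, KK ρ s • HH a I (t + s) =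
      (2 * Real.pi) • (evalS a ((ρ : Quaternion ℝ) * ptOn I t) - a 0) := by
  have h := KK_int h0 h1 (g := fun s => HH a I (t + s)) ((HH_cont ha hI).comp (by fun_prop))
  have hs : Summable fun n => ‖ρ ^ n • a n‖ := by
    simpa [norm_smul, abs_of_nonneg h0] using geo_summable ha h0 h1
  have h2 := (ser_summable hI (fun n : ℕ => (n : ℤ)) hs t).hasSum
  have h3 : HasSum (fun n : ℕ => if n = 0 then a 0 else 0) (a 0) := by
      have := hasSum_single (f := fun n : ℕ => if n = 0 then a 0 else 0) 0
        (fun b hb => if_neg hb)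
      rwa [if_pos rfl] at this
  have h4 := (h2.sub h3).const_smul (2 * Real.pi)
  rw [evalS_ser a hI, ser, ← h4.tsum_eq, ← h.tsum_eq]
  apply tsum_congr
  intro n
  by_cases hn : n = 0
  · subst hn; simp [pt_zero]
  · rw [int_sin_HH ha hI t n hn, if_neg hn, sub_zero]
    simp only [Int.cast_natCast]
    rw [mul_smul_comm, ← cc_mul a hI n hn (n * t)]
    simp only [smul_smul]
    congr 1; ring

theorem HHr_lip {a : ℕ → Quaternion ℝ} (ha : MemH2 a) {I : Quaternion ℝ} (hI : I ∈ USphere)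
    (hb : ∀ q ∈ QBall, ‖evalS a q‖ ≤ 1) {r : ℝ} (h0 : 0 ≤ r) (h1 : r < 1) (s t : ℝ) :
    ‖(∑' n : ℕ, r ^ n • (ptOn I (n * s) * cc a I n)) - ∑' n : ℕ, r ^ n • (ptOn I (n * t) * cc a I n)‖
      ≤ (1 + ‖a 0‖) * ‖s - t‖ := by
  have hs : Summable fun n => ‖r ^ n • a n‖ := by
    simpa [norm_smul, abs_of_nonneg h0] using geo_summable ha h0 h1
  have hd : ∀ (n : ℕ) (t : ℝ), HasDerivAt (fun t : ℝ => r ^ n • (ptOn I (n * t) * cc a I n))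
      (if n = 0 then 0 else ptOn I (n * t) * (r ^ n • a n)) t := by
    intro n t
    have e1 : HasDerivAt (fun s : ℝ => (n : ℝ) * s) n t := by
      simpa using (hasDerivAt_id t).const_mul (n : ℝ)
    have e2 : HasDerivAt (fun s : ℝ => ptOn I (n * s)) ((n : ℝ) • (I * ptOn I (n * t))) t := by
      simp only [pt_eq]
      have := (e1.cos.smul_const (1 : Quaternion ℝ)).add (e1.sin.smul_const I)
      convert! this using 1
      simp only [mul_add, mul_smul_comm, us_mul hI, mul_one]
      module
    have e3 := (e2.mul_const (cc a I n)).const_smul (r ^ n)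
    convert! e3 using 1
    split_ifs with hn
    · subst hn; simp
    · rw [mul_smul_comm, ← cc_mul a hI n hn, smul_mul_assoc, mul_assoc]
  have hH : ∀ t : ℝ, HasDerivAt (fun t : ℝ => ∑' n : ℕ, r ^ n • (ptOn I (n * t) * cc a I n))
      (∑' n : ℕ, if n = 0 then 0 else ptOn I (n * t) * (r ^ n • a n)) t := by
    refine hasDerivAt_tsum hs hd (fun n y => ?_) (y₀ := 0) ?_
    · split_ifs
      · rw [norm_zero]; exact norm_nonneg _
      · rw [norm_mul, pt_norm hI, one_mul]
    · apply Summable.of_norm_bounded (cc_summable ha hI)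
      intro n
      rw [norm_smul, norm_mul, pt_norm hI, one_mul, Real.norm_of_nonneg (by positivity)]
      exact mul_le_of_le_one_left (norm_nonneg _) (pow_le_one₀ h0 h1.le)
  have hv : ∀ t : ℝ, (∑' n : ℕ, if n = 0 then 0 else ptOn I (n * t) * (r ^ n • a n)) =
      evalS a ((r : Quaternion ℝ) * ptOn I t) - a 0 := by
    intro t
    have h2 := (ser_summable hI (fun n : ℕ => (n : ℤ)) hs t).hasSum
    have h3 : HasSum (fun n : ℕ => if n = 0 then a 0 else 0) (a 0) := by
      have := hasSum_single (f := fun n : ℕ => if n = 0 then a 0 else 0) 0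
        (fun b hb => if_neg hb)
      rwa [if_pos rfl] at this
    rw [evalS_ser a hI, ser, ← (h2.sub h3).tsum_eq]
    apply tsum_congr
    intro n
    by_cases hn : n = 0
    · subst hn; simp [pt_zero]
    · rw [if_neg hn, if_neg hn, sub_zero]; simp
  have := (convex_univ (𝕜 := ℝ) (E := ℝ)).norm_image_sub_le_of_norm_hasDerivWithin_le
    (f := fun t : ℝ => ∑' n : ℕ, r ^ n • (ptOn I (n * t) * cc a I n)) (C := 1 + ‖a 0‖)
    (fun x _ => (hH x).hasDerivWithinAt) (fun x _ => ?_) (Set.mem_univ t) (Set.mem_univ s)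
  · exact this
  · rw [hv]
    exact (norm_sub_le _ _).trans (by gcongr; exact hb _ (mem_ball hI h0 h1 x))

theorem HH_lip {a : ℕ → Quaternion ℝ} (ha : MemH2 a) {I : Quaternion ℝ} (hI : I ∈ USphere)
    (hb : ∀ q ∈ QBall, ‖evalS a q‖ ≤ 1) :
    LipschitzWith (1 + ‖a 0‖).toNNReal (HH a I) := by
  apply LipschitzWith.of_dist_le_mul
  intro s t
  rw [dist_eq_norm, dist_eq_norm, Real.coe_toNNReal _ (by positivity)]
  have hl : ∀ t : ℝ, Tendsto (fun r : ℝ => ∑' n : ℕ, r ^ n • (ptOn I (n * t) * cc a I n))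
      (𝓝[<] 1) (𝓝 (HH a I t)) := by
    intro t
    have : HH a I t = ∑' n : ℕ, (1:ℝ) ^ n • (ptOn I (n * t) * cc a I n) := by
      simp [HH, ser]
    rw [this]
    apply tendsto_tsum_of_dominated_convergence (cc_summable ha hI)
    · intro n
      apply Tendsto.smul_const
      exact ((continuous_pow n).tendsto 1).mono_left nhdsWithin_le_nhds
    · filter_upwards [Ioo_mem_nhdsLT (show (0:ℝ) < 1 by norm_num)] with r hr n
      rw [norm_smul, norm_mul, pt_norm hI, one_mul, Real.norm_of_nonneg (pow_nonneg hr.1.le _)]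
      exact mul_le_of_le_one_left (norm_nonneg _) (pow_le_one₀ hr.1.le hr.2.le)
  refine le_of_tendsto ((hl s).sub (hl t)).norm ?_
  filter_upwards [Ioo_mem_nhdsLT (show (0:ℝ) < 1 by norm_num)] with r hr
  exact HHr_lip ha hI hb hr.1.le hr.2 s t

theorem fatou {a : ℕ → Quaternion ℝ} (ha : MemH2 a) {I : Quaternion ℝ} (hI : I ∈ USphere)
    (hb : ∀ q ∈ QBall, ‖evalS a q‖ ≤ 1) :
    ∀ᵐ t : ℝ, ∃ L, Tendsto (fun r : ℝ => evalS a ((r : Quaternion ℝ) * ptOn I t)) (𝓝[<] (1 : ℝ)) (𝓝 L) := by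
  filter_upwards [(HH_lip ha hI hb).ae_differentiableAt_real] with t ht
  have hpi := Real.pi_pos
  have hcd : Continuous (dslope (HH a I) t) := by
    rw [← continuousOn_univ, continuousOn_dslope univ_mem]
    exact ⟨(HH_cont ha hI).continuousOn, ht⟩
  have hcg : Continuous (fun s => dslope (HH a I) t (t + s)) := hcd.comp (by fun_prop)
  have hev : ∀ᶠ ρ in 𝓝[<] (1:ℝ), 1/2 ≤ ρ ∧ ρ < 1 := by
    filter_upwards [Ioo_mem_nhdsLT (show (1/2:ℝ) < 1 by norm_num)] with r hr using ⟨hr.1.le, hr.2⟩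
  have key := tendsto_setIntegral_peak_smul_of_integrableOn_of_tendsto (μ := (volume : Measure ℝ))
    (s := Set.Ioc (-Real.pi) Real.pi) (t := Set.Ioc (-Real.pi) Real.pi) (x₀ := (0:ℝ))
    (l := 𝓝[<] (1:ℝ)) (φ := fun ρ s => (2 * Real.pi)⁻¹ * (KK ρ s * s))
    (g := fun s => dslope (HH a I) t (t + s)) (a := dslope (HH a I) t (t + 0))
    measurableSet_Ioc measurableSet_Ioc subset_rfl self_mem_nhdsWithin (by simp)
    (by
      filter_upwards [hev] with ρ hρ s hs
      have := KK_nonneg (by linarith [hρ.1]) hρ.2 (Set.Ioc_subset_Icc_self hs)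
      positivity)
    (by
      intro u hu h0u
      obtain ⟨δ, hδ, hsub⟩ := Metric.isOpen_iff.1 hu 0 h0u
      rw [Metric.tendstoUniformlyOn_iff]
      intro ε hε
      have hlim : Tendsto (fun ρ : ℝ => (2 * Real.pi)⁻¹ * (2 * Real.pi * (1 - ρ ^ 2) / (1 - Real.cos δ) ^ 2))
          (𝓝[<] 1) (𝓝 0) := by
        have : Continuous (fun ρ : ℝ => (2 * Real.pi)⁻¹ * (2 * Real.pi * (1 - ρ ^ 2) / (1 - Real.cos δ) ^ 2)) := by
          fun_prop
        have h2 := (this.tendsto 1).mono_left (nhdsWithin_le_nhds (s := Set.Iio 1))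
        simpa using h2
      filter_upwards [hev, hlim.eventually (gt_mem_nhds hε)] with ρ hρ hlt s hs
      have hs' := Set.Ioc_subset_Icc_self hs.1
      have hds : δ ≤ |s| := by
        by_contra hh
        exact hs.2 (hsub (by simpa using hh))
      have hnn := KK_nonneg (by linarith [hρ.1]) hρ.2 hs'
      have hsm := KK_small hδ hρ.1 hρ.2 hs' hds
      simp only [Pi.zero_apply, dist_zero_left]
      rw [Real.norm_of_nonneg (by positivity)]
      refine lt_of_le_of_lt ?_ hlt
      gcongr)
    (by
      have h1 : Tendsto (fun ρ : ℝ => (2 * Real.pi)⁻¹ * (4 * Real.pi * ρ / (1 + ρ))) (𝓝[<] 1) (𝓝 1) := by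
        have : ContinuousAt (fun ρ : ℝ => (2 * Real.pi)⁻¹ * (4 * Real.pi * ρ / (1 + ρ))) 1 := by
          apply ContinuousAt.mul continuousAt_const
          apply ContinuousAt.div (by fun_prop) (by fun_prop) (by norm_num)
        have h2 := this.tendsto.mono_left (nhdsWithin_le_nhds (s := Set.Iio 1))
        convert! h2 using 2
        field_simp; norm_num
      refine h1.congr' ?_
      filter_upwards [hev] with ρ hρ
      rw [← intervalIntegral.integral_of_le (by linarith), intervalIntegral.integral_const_mul,
        KK_int_s (by linarith [hρ.1]) hρ.2])
    (by
      filter_upwards [hev] with ρ hρ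
      have := KK_cont (ρ := ρ) (by linarith [hρ.1]) hρ.2
      apply Continuous.aestronglyMeasurable
      fun_prop)
    ((hcg.continuousOn (s := Set.Icc (-Real.pi) Real.pi)).integrableOn_Icc.mono_set Set.Ioc_subset_Icc_self)
    ((hcg.tendsto 0).mono_left nhdsWithin_le_nhds)
  refine ⟨dslope (HH a I) t (t + 0) + a 0, ?_⟩
  refine (key.add_const (a 0)).congr' ?_
  filter_upwards [hev] with ρ hρ
  have h0 : 0 ≤ ρ := by linarith [hρ.1]
  have hK := KK_cont h0 hρ.2
  rw [← intervalIntegral.integral_of_le (by linarith)]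
  have e : ∀ s : ℝ, ((2 * Real.pi)⁻¹ * (KK ρ s * s)) • dslope (HH a I) t (t + s) =
      (2 * Real.pi)⁻¹ • (KK ρ s • HH a I (t + s) - KK ρ s • HH a I t) := by
    intro s
    have := sub_smul_dslope (HH a I) t (t + s)
    rw [add_sub_cancel_left] at this
    rw [← smul_sub, ← this, smul_smul, smul_smul, mul_assoc]
  simp only [e]
  rw [intervalIntegral.integral_smul, intervalIntegral.integral_sub, HH_rep ha hI h0 hρ.2,
    intervalIntegral.integral_smul_const, KK_int_zero, zero_smul, sub_zero, smul_smul]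
  · rw [inv_mul_cancel₀ (by positivity)]; simp
  · apply Continuous.intervalIntegrable
    exact hK.smul ((HH_cont ha hI).comp (by fun_prop))
  · apply Continuous.intervalIntegrable
    exact hK.smul continuous_const


theorem bdval_eq {a : ℕ → Quaternion ℝ} {q L : Quaternion ℝ}
    (h : Tendsto (fun r : ℝ => evalS a ((r : Quaternion ℝ) * q)) (𝓝[<] (1 : ℝ)) (𝓝 L)) :
    bdval a q = L := by
  have hex : ∃ L, Tendsto (fun r : ℝ => evalS a ((r : Quaternion ℝ) * q)) (𝓝[<] (1 : ℝ)) (𝓝 L) := ⟨L, h⟩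
  rw [bdval, dif_pos hex]
  exact tendsto_nhds_unique hex.choose_spec h

theorem ev01 : ∀ᶠ r in 𝓝[<] (1:ℝ), 0 ≤ r ∧ r < 1 := by
  filter_upwards [Ioo_mem_nhdsLT (show (0:ℝ) < 1 by norm_num)] with r hr using ⟨hr.1.le, hr.2⟩

theorem evalS_cont {a : ℕ → Quaternion ℝ} (ha : MemH2 a) {I : Quaternion ℝ} (hI : I ∈ USphere)
    {r : ℝ} (h0 : 0 ≤ r) (h1 : r < 1) :
    Continuous fun t => evalS a ((r : Quaternion ℝ) * ptOn I t) := by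
  simp only [evalS_ser a hI]
  apply ser_cont hI
  simpa [norm_smul, abs_of_nonneg h0] using geo_summable ha h0 h1

theorem bd_lim {a : ℕ → Quaternion ℝ} (ha : MemH2 a) {I : Quaternion ℝ} (hI : I ∈ USphere)
    (hb : ∀ q ∈ QBall, ‖evalS a q‖ ≤ 1) :
    ∀ᵐ t : ℝ, Tendsto (fun r : ℝ => evalS a ((r : Quaternion ℝ) * ptOn I t)) (𝓝[<] (1 : ℝ))
      (𝓝 (bdval a (ptOn I t))) := by
  filter_upwards [fatou ha hI hb] with t ht
  obtain ⟨L, hL⟩ := ht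
  rw [bdval_eq hL]; exact hL

theorem bd_le {a : ℕ → Quaternion ℝ} (ha : MemH2 a) {I : Quaternion ℝ} (hI : I ∈ USphere)
    (hb : ∀ q ∈ QBall, ‖evalS a q‖ ≤ 1) :
    ∀ᵐ t : ℝ, ‖bdval a (ptOn I t)‖ ≤ 1 := by
  filter_upwards [bd_lim ha hI hb] with t ht
  refine le_of_tendsto ht.norm ?_
  filter_upwards [ev01] with r hr using hb _ (mem_ball hI hr.1 hr.2 t)

theorem bd_meas {a : ℕ → Quaternion ℝ} (ha : MemH2 a) {I : Quaternion ℝ} (hI : I ∈ USphere)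
    (hb : ∀ q ∈ QBall, ‖evalS a q‖ ≤ 1) :
    AEStronglyMeasurable (fun t : ℝ => bdval a (ptOn I t)) volume := by
  have hu : Tendsto (fun n : ℕ => 1 - 1 / ((n : ℝ) + 1)) atTop (𝓝[<] 1) := by
    rw [tendsto_nhdsWithin_iff]
    constructor
    · simpa using tendsto_one_div_add_atTop_nhds_zero_nat.const_sub (1:ℝ)
    · filter_upwards with n
      have : 0 < 1 / ((n : ℝ) + 1) := by positivity
      simp only [Set.mem_Iio]; linarith
  refine aestronglyMeasurable_of_tendsto_ae atTop
    (f := fun (n : ℕ) (t : ℝ) => evalS a (((1 - 1 / ((n : ℝ) + 1) : ℝ) : Quaternion ℝ) * ptOn I t)) ?_ ?_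
  · intro n
    have h1 : 0 < 1 / ((n : ℝ) + 1) := by positivity
    have h2 : 1 / ((n : ℝ) + 1) ≤ 1 := by
      rw [div_le_one (by positivity)]; linarith [Nat.cast_nonneg (α := ℝ) n]
    exact (evalS_cont ha hI (by linarith) (by linarith)).aestronglyMeasurable
  · filter_upwards [bd_lim ha hI hb] with t ht using ht.comp hu

theorem bd_int {a : ℕ → Quaternion ℝ} (ha : MemH2 a) {I : Quaternion ℝ} (hI : I ∈ USphere)
    (hb : ∀ q ∈ QBall, ‖evalS a q‖ ≤ 1) :
    ∫ t in (0:ℝ)..(2 * Real.pi), ‖bdval a (ptOn I t)‖ ^ 2 = 2 * Real.pi * ∑' n, ‖a n‖ ^ 2 := by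
  have h1 : Tendsto (fun r : ℝ => ∫ t in (0:ℝ)..(2 * Real.pi), ‖evalS a ((r : Quaternion ℝ) * ptOn I t)‖^2)
      (𝓝[<] 1) (𝓝 (∫ t in (0:ℝ)..(2 * Real.pi), ‖bdval a (ptOn I t)‖ ^ 2)) := by
    apply intervalIntegral.tendsto_integral_filter_of_dominated_convergence (fun _ => 1)
    · filter_upwards [ev01] with r hr
      exact ((evalS_cont ha hI hr.1 hr.2).norm.pow 2).aestronglyMeasurable
    · filter_upwards [ev01] with r hr
      filter_upwards with t _
      rw [Real.norm_of_nonneg (by positivity)]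
      exact pow_le_one₀ (norm_nonneg _) (hb _ (mem_ball hI hr.1 hr.2 t))
    · exact intervalIntegrable_const
    · filter_upwards [bd_lim ha hI hb] with t ht _ using ht.norm.pow 2
  have h2 : Tendsto (fun r : ℝ => ∑' n, 2 * Real.pi * (r ^ (2 * n) * ‖a n‖^2))
      (𝓝[<] 1) (𝓝 (∑' n, 2 * Real.pi * ((1:ℝ) ^ (2 * n) * ‖a n‖^2))) := by
    apply tendsto_tsum_of_dominated_convergence (bound := fun n => 2 * Real.pi * ‖a n‖ ^ 2) (ha.mul_left _)
    · intro n
      have : Continuous (fun r : ℝ => 2 * Real.pi * (r ^ (2 * n) * ‖a n‖^2)) := by fun_prop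
      exact (this.tendsto 1).mono_left nhdsWithin_le_nhds
    · filter_upwards [ev01] with r hr n
      have := Real.pi_pos
      have h0 := hr.1
      rw [Real.norm_of_nonneg (by positivity)]
      gcongr
      exact mul_le_of_le_one_left (by positivity) (pow_le_one₀ hr.1 hr.2.le)
  have h3 := h2.congr' (f₂ := fun r : ℝ => ∫ t in (0:ℝ)..(2 * Real.pi), ‖evalS a ((r : Quaternion ℝ) * ptOn I t)‖^2)
    (by filter_upwards [ev01] with r hr using (parsevalS ha hI hr.1 hr.2).tsum_eq)
  rw [tendsto_nhds_unique h1 h3, ← tsum_mul_left]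
  simp

theorem sum_eq_one {a : ℕ → Quaternion ℝ} (ha : MemH2 a) {I : Quaternion ℝ} (hI : I ∈ USphere)
    (hb : ∀ q ∈ QBall, ‖evalS a q‖ ≤ 1)
    (h : ∀ᵐ t ∂(volume.restrict (Set.Ico 0 (2 * Real.pi))), ‖bdval a (ptOn I t)‖ = 1) :
    ∑' n, ‖a n‖ ^ 2 = 1 := by
  have h1 := bd_int ha hI hb
  have hpi := Real.pi_pos
  rw [intervalIntegral.integral_of_le (by positivity), ← integral_Ico_eq_integral_Ioc] at h1
  have h2 : ∫ t in Set.Ico 0 (2 * Real.pi), ‖bdval a (ptOn I t)‖ ^ 2 = ∫ t in Set.Ico 0 (2 * Real.pi), (1:ℝ) := by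
    apply integral_congr_ae
    filter_upwards [h] with t ht
    rw [ht]; simp
  rw [h2] at h1
  simp only [integral_const, smul_eq_mul, mul_one] at h1
  rw [measureReal_restrict_apply_univ, Real.volume_real_Ico_of_le (by positivity), sub_zero] at h1
  have h3 : (2 * Real.pi) * (∑' n, ‖a n‖ ^ 2 - 1) = 0 := by linarith
  rcases mul_eq_zero.1 h3 with h | h
  · linarith
  · linarith

theorem bd_one {a : ℕ → Quaternion ℝ} (ha : MemH2 a) {I : Quaternion ℝ} (hI : I ∈ USphere)
    (hb : ∀ q ∈ QBall, ‖evalS a q‖ ≤ 1) (hn : ∑' n, ‖a n‖ ^ 2 = 1) :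
    ∀ᵐ t ∂(volume.restrict (Set.Ico 0 (2 * Real.pi))), ‖bdval a (ptOn I t)‖ = 1 := by
  have h1 := bd_int ha hI hb
  have hpi := Real.pi_pos
  rw [intervalIntegral.integral_of_le (by positivity), ← integral_Ico_eq_integral_Ioc, hn, mul_one] at h1
  have hle := ae_restrict_of_ae (s := Set.Ico 0 (2 * Real.pi)) (bd_le ha hI hb)
  have hInt1 : Integrable (fun t : ℝ => ‖bdval a (ptOn I t)‖ ^ 2) (volume.restrict (Set.Ico 0 (2 * Real.pi))) := by
    refine Integrable.mono' (integrable_const (1:ℝ)) ((bd_meas ha hI hb).restrict.norm.pow 2) ?_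
    filter_upwards [hle] with t ht
    rw [Real.norm_of_nonneg (by positivity)]
    exact pow_le_one₀ (norm_nonneg _) ht
  have h2 : ∫ t in Set.Ico 0 (2 * Real.pi), (1 - ‖bdval a (ptOn I t)‖ ^ 2) = 0 := by
    rw [integral_sub (integrable_const _) hInt1, h1]
    simp only [integral_const, smul_eq_mul, mul_one]
    rw [measureReal_restrict_apply_univ, Real.volume_real_Ico_of_le (by positivity)]; ring
  have hi2 : Integrable (fun t : ℝ => 1 - ‖bdval a (ptOn I t)‖ ^ 2)
      (volume.restrict (Set.Ico 0 (2 * Real.pi))) := (integrable_const (1:ℝ)).sub hInt1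
  rw [integral_eq_zero_iff_of_nonneg_ae _ hi2] at h2
  · filter_upwards [h2] with t ht
    simp only [Pi.zero_apply] at ht
    have : (‖bdval a (ptOn I t)‖ - 1) * (‖bdval a (ptOn I t)‖ + 1) = 0 := by linarith
    rcases mul_eq_zero.1 this with h | h
    · linarith
    · linarith [norm_nonneg (bdval a (ptOn I t))]
  · filter_upwards [hle] with t ht
    have := pow_le_one₀ (norm_nonneg _) ht (n := 2)
    simp only [Pi.zero_apply]; linarith

theorem rep_formula {a : ℕ → Quaternion ℝ} (ha : MemH2 a) {I J : Quaternion ℝ} (hI : I ∈ USphere)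
    (hJ : J ∈ USphere) {r : ℝ} (h0 : 0 ≤ r) (h1 : r < 1) (t : ℝ) :
    evalS a ((r : Quaternion ℝ) * ptOn J t) =
      (1/2 : ℝ) • (evalS a ((r : Quaternion ℝ) * ptOn I t) + evalS a ((r : Quaternion ℝ) * ptOn (-I) t)) +
      J * ((1/2 : ℝ) • (I * (evalS a ((r : Quaternion ℝ) * ptOn (-I) t) - evalS a ((r : Quaternion ℝ) * ptOn I t)))) := by
  have hs : Summable fun n => ‖r ^ n • a n‖ := by
    simpa [norm_smul, abs_of_nonneg h0] using geo_summable ha h0 h1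
  have e1 := (ser_summable hI (fun n : ℕ => (n : ℤ)) hs t).hasSum
  have e2 := (ser_summable (us_neg hI) (fun n : ℕ => (n : ℤ)) hs t).hasSum
  have e3 := (ser_summable hJ (fun n : ℕ => (n : ℤ)) hs t).hasSum
  have e4 := ((e1.add e2).const_smul (1/2 : ℝ)).add
    ((((e2.sub e1).mul_left I).const_smul (1/2 : ℝ)).mul_left J)
  rw [evalS_ser a hJ, evalS_ser a hI, evalS_ser a (us_neg hI), ser, ser, ser]
  refine e3.unique ?_
  convert! e4 using 1
  funext n
  rw [← add_mul, ← sub_mul, ← mul_assoc I, ← smul_mul_assoc, ← smul_mul_assoc, ← mul_assoc J, ← add_mul]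
  congr 1
  simp only [pt_eq]
  have h2 : (Real.cos ((n:ℤ) * t) • (1 : Quaternion ℝ) + Real.sin ((n:ℤ) * t) • -I -
      (Real.cos ((n:ℤ) * t) • (1 : Quaternion ℝ) + Real.sin ((n:ℤ) * t) • I))
      = (-2 * Real.sin ((n:ℤ) * t)) • I := by module
  simp only [h2, mul_smul_comm, us_mul hI, mul_neg, mul_one]
  module

theorem us_decomp {J : Quaternion ℝ} (hJ : J ∈ USphere) :
    J = J.imI • qi + J.imJ • qj + J.imK • qk := by
  have := (us_re hJ).1
  ext <;> simp [this]

theorem affine_norm {A B : Quaternion ℝ} (h : ∀ J ∈ ({qi, -qi, qj, -qj, qk, -qk} : Set (Quaternion ℝ)),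
    ‖A + J * B‖ = 1) {J : Quaternion ℝ} (hJ : J ∈ USphere) : ‖A + J * B‖ = 1 := by
  have key : ∀ J ∈ USphere, ‖A + J * B‖ ^ 2 = ‖A‖ ^ 2 + 2 * inner ℝ A (J * B) + ‖B‖ ^ 2 := by
    intro J hJ
    rw [norm_add_sq_real, norm_mul, us_norm hJ, one_mul]
  have two : ∀ J ∈ USphere, ‖A + J * B‖ = 1 → ‖A + (-J) * B‖ = 1 →
      inner ℝ A (J * B) = 0 ∧ ‖A‖ ^ 2 + ‖B‖ ^ 2 = 1 := by
    intro J hJ h1 h2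
    have k1 := key J hJ
    have k2 := key (-J) (us_neg hJ)
    rw [h1] at k1
    rw [h2, neg_mul, inner_neg_right] at k2
    constructor <;> linarith
  obtain ⟨x1, y⟩ := two qi qi_us (h _ (by simp)) (h _ (by simp))
  obtain ⟨x2, -⟩ := two qj qj_us (h _ (by simp)) (h _ (by simp))
  obtain ⟨x3, -⟩ := two qk qk_us (h _ (by simp)) (h _ (by simp))
  have z : inner ℝ A (J * B) = 0 := by
    rw [us_decomp hJ]
    simp only [add_mul, smul_mul_assoc, inner_add_right, inner_smul_right, x1, x2, x3]
    simp
  have k := key J hJ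
  rw [z] at k
  have : (‖A + J * B‖ - 1) * (‖A + J * B‖ + 1) = 0 := by linarith
  rcases mul_eq_zero.1 this with h | h
  · linarith
  · linarith [norm_nonneg (A + J * B)]

theorem bd_all {a : ℕ → Quaternion ℝ} (ha : MemH2 a)
    (hb : ∀ q ∈ QBall, ‖evalS a q‖ ≤ 1) (hn : ∑' n, ‖a n‖ ^ 2 = 1) :
    ∀ᵐ t ∂(volume.restrict (Set.Ico 0 (2 * Real.pi))), ∀ J ∈ USphere, ‖bdval a (ptOn J t)‖ = 1 := by
  have l1 := ae_restrict_of_ae (s := Set.Ico 0 (2 * Real.pi)) (bd_lim ha qi_us hb)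
  have l2 := ae_restrict_of_ae (s := Set.Ico 0 (2 * Real.pi)) (bd_lim ha (us_neg qi_us) hb)
  filter_upwards [l1, l2, bd_one ha qi_us hb hn, bd_one ha (us_neg qi_us) hb hn,
    bd_one ha qj_us hb hn, bd_one ha (us_neg qj_us) hb hn,
    bd_one ha qk_us hb hn, bd_one ha (us_neg qk_us) hb hn] with t l1 l2 i1 i2 j1 j2 k1 k2
  set A := (1/2 : ℝ) • (bdval a (ptOn qi t) + bdval a (ptOn (-qi) t))
  set B := (1/2 : ℝ) • (qi * (bdval a (ptOn (-qi) t) - bdval a (ptOn qi t)))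
  have hlim : ∀ J ∈ USphere, bdval a (ptOn J t) = A + J * B := by
    intro J hJ
    apply bdval_eq
    have := ((l1.add l2).const_smul (1/2 : ℝ)).add
      ((((l2.sub l1).const_mul qi).const_smul (1/2 : ℝ)).const_mul J)
    refine this.congr' ?_
    filter_upwards [ev01] with r hr
    rw [rep_formula ha qi_us hJ hr.1 hr.2]
  intro J hJ
  rw [hlim J hJ]
  apply affine_norm _ hJ
  intro J hJ
  simp only [Set.mem_insert_iff, Set.mem_singleton_iff] at hJ
  rcases hJ with rfl | rfl | rfl | rfl | rfl | rfl
  · rw [← hlim _ qi_us]; exact i1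
  · rw [← hlim _ (us_neg qi_us)]; exact i2
  · rw [← hlim _ qj_us]; exact j1
  · rw [← hlim _ (us_neg qj_us)]; exact j2
  · rw [← hlim _ qk_us]; exact k1
  · rw [← hlim _ (us_neg qk_us)]; exact k2


theorem qnorm_sq (q : Quaternion ℝ) : ‖q‖ ^ 2 = q.re ^ 2 + q.imI ^ 2 + q.imJ ^ 2 + q.imK ^ 2 := by
  rw [sq, ← Quaternion.normSq_eq_norm_mul_self, Quaternion.normSq_def']

theorem us_closed : IsClosed USphere := by
  unfold USphere
  exact isClosed_eq (continuous_pow 2) continuous_const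

theorem us_meas : MeasurableSet USphere := us_closed.measurableSet

theorem us_pos : μH[2] USphere ≠ 0 := by
  intro h
  have hl : LipschitzWith 1 (fun q : Quaternion ℝ => ((q.imJ, q.imK) : ℝ × ℝ)) := by
    apply LipschitzWith.of_dist_le_mul
    intro p q
    rw [dist_eq_norm p q, Prod.dist_eq, Real.dist_eq, Real.dist_eq]
    have := qnorm_sq (p - q)
    simp only [Quaternion.re_sub, Quaternion.imI_sub, Quaternion.imJ_sub, Quaternion.imK_sub] at this
    rw [NNReal.coe_one, one_mul]
    apply max_le
    · apply abs_le_of_sq_le_sq _ (norm_nonneg _)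
      nlinarith [sq_nonneg (p.re - q.re), sq_nonneg (p.imI - q.imI), sq_nonneg (p.imK - q.imK)]
    · apply abs_le_of_sq_le_sq _ (norm_nonneg _)
      nlinarith [sq_nonneg (p.re - q.re), sq_nonneg (p.imI - q.imI), sq_nonneg (p.imJ - q.imJ)]
  have h1 := hl.hausdorffMeasure_image_le (d := 2) (by norm_num) USphere
  rw [h, mul_zero, hausdorffMeasure_prod_real] at h1
  have h2 : Metric.ball (0 : ℝ × ℝ) (1/2) ⊆ (fun q : Quaternion ℝ => ((q.imJ, q.imK) : ℝ × ℝ)) '' USphere := by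
    rintro ⟨x, y⟩ hxy
    rw [mem_ball_zero_iff, Prod.norm_def, max_lt_iff, Real.norm_eq_abs, Real.norm_eq_abs] at hxy
    have hx := abs_lt.1 hxy.1
    have hy := abs_lt.1 hxy.2
    simp only at hx hy
    have hx2 : x ^ 2 ≤ 1/4 := by nlinarith
    have hy2 : y ^ 2 ≤ 1/4 := by nlinarith
    refine ⟨⟨0, Real.sqrt (1 - x ^ 2 - y ^ 2), x, y⟩, us_of rfl ?_, rfl⟩
    show (Real.sqrt (1 - x ^ 2 - y ^ 2)) ^ 2 + x ^ 2 + y ^ 2 = 1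
    rw [Real.sq_sqrt (by linarith)]; ring
  have h3 := Metric.measure_ball_pos (volume : Measure (ℝ × ℝ)) 0 (show (0:ℝ) < 1/2 by norm_num)
  exact absurd (h3.trans_le ((measure_mono h2).trans h1)) (lt_irrefl _)

theorem us_fin : μH[2] USphere ≠ ∞ := by
  set Φ : ℝ × ℝ → Quaternion ℝ := fun p =>
    Real.cos p.1 • qi + (Real.sin p.1 * Real.cos p.2) • qj + (Real.sin p.1 * Real.sin p.2) • qk
  have hl : LipschitzWith 5 Φ := by
    apply LipschitzWith.of_dist_le_mul
    rintro ⟨u, v⟩ ⟨u', v'⟩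
    rw [dist_eq_norm, Prod.dist_eq, Real.dist_eq, Real.dist_eq]
    set m := max |u - u'| |v - v'|
    have hu : |u - u'| ≤ m := le_max_left _ _
    have hv : |v - v'| ≤ m := le_max_right _ _
    have e : Φ (u, v) - Φ (u', v') = (Real.cos u - Real.cos u') • qi +
      (Real.sin u * Real.cos v - Real.sin u' * Real.cos v') • qj +
      (Real.sin u * Real.sin v - Real.sin u' * Real.sin v') • qk := by
      simp only [Φ]; module
    rw [e]
    have b1 : |Real.cos u - Real.cos u'| ≤ m := (Real.abs_cos_sub_cos_le u u').trans hu
    have b2 : |Real.sin u * Real.cos v - Real.sin u' * Real.cos v'| ≤ 2 * m := by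
      have : Real.sin u * Real.cos v - Real.sin u' * Real.cos v' =
        (Real.sin u - Real.sin u') * Real.cos v + Real.sin u' * (Real.cos v - Real.cos v') := by ring
      rw [this]
      refine (abs_add_le _ _).trans ?_
      rw [abs_mul, abs_mul]
      have c1 := (Real.abs_sin_sub_sin_le u u').trans hu
      have c2 := (Real.abs_cos_sub_cos_le v v').trans hv
      have c3 := Real.abs_cos_le_one v
      have c4 := Real.abs_sin_le_one u'
      nlinarith [mul_le_mul c1 c3 (abs_nonneg _) ((abs_nonneg _).trans hu),
        mul_le_mul c4 c2 (abs_nonneg _) (by norm_num)]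
    have b3 : |Real.sin u * Real.sin v - Real.sin u' * Real.sin v'| ≤ 2 * m := by
      have : Real.sin u * Real.sin v - Real.sin u' * Real.sin v' =
        (Real.sin u - Real.sin u') * Real.sin v + Real.sin u' * (Real.sin v - Real.sin v') := by ring
      rw [this]
      refine (abs_add_le _ _).trans ?_
      rw [abs_mul, abs_mul]
      have c1 := (Real.abs_sin_sub_sin_le u u').trans hu
      have c2 := (Real.abs_sin_sub_sin_le v v').trans hv
      have c3 := Real.abs_sin_le_one v
      have c4 := Real.abs_sin_le_one u'
      nlinarith [mul_le_mul c1 c3 (abs_nonneg _) ((abs_nonneg _).trans hu),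
        mul_le_mul c4 c2 (abs_nonneg _) (by norm_num)]
    refine (norm_add_le _ _).trans ((add_le_add_left (norm_add_le _ _) _).trans ?_)
    rw [norm_smul, norm_smul, norm_smul, us_norm qi_us, us_norm qj_us, us_norm qk_us,
      Real.norm_eq_abs, Real.norm_eq_abs, Real.norm_eq_abs]
    have : ((5 : NNReal) : ℝ) = 5 := rfl
    rw [this]
    linarith
  have hsub : USphere ⊆ Φ '' (Set.Icc (-Real.pi) Real.pi ×ˢ Set.Icc (-Real.pi) Real.pi) := by
    intro J hJ
    obtain ⟨h0, h1⟩ := us_re hJ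
    set z : ℂ := ⟨J.imJ, J.imK⟩
    have hi1 : -1 ≤ J.imI := by nlinarith [sq_nonneg J.imJ, sq_nonneg J.imK]
    have hi2 : J.imI ≤ 1 := by nlinarith [sq_nonneg J.imJ, sq_nonneg J.imK]
    have hsin : Real.sin (Real.arccos J.imI) = ‖z‖ := by
      rw [Real.sin_arccos, Complex.norm_def, Complex.normSq_apply]
      congr 1
      simp only [z]; linarith
    have hpi := Real.pi_pos
    refine ⟨(Real.arccos J.imI, z.arg), ⟨⟨?_, Real.arccos_le_pi _⟩,
      ⟨(Complex.neg_pi_lt_arg z).le, Complex.arg_le_pi z⟩⟩, ?_⟩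
    · linarith [Real.arccos_nonneg J.imI]
    · conv_rhs => rw [us_decomp hJ]
      simp only [Φ, hsin, Real.cos_arccos hi1 hi2, Complex.norm_mul_cos_arg, Complex.norm_mul_sin_arg, z]
  have h1 := (measure_mono hsub).trans (hl.hausdorffMeasure_image_le (d := 2) (by norm_num) _)
  rw [hausdorffMeasure_prod_real] at h1
  refine ne_top_of_le_ne_top ?_ h1
  apply ENNReal.mul_ne_top
  · exact ENNReal.rpow_ne_top_of_nonneg (by norm_num) (by simp)
  · exact (isCompact_Icc.prod isCompact_Icc).measure_ne_top

instance sph_fin : IsFiniteMeasure sphMeasure := by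
  constructor
  rw [sphMeasure, Measure.smul_apply, Measure.restrict_apply_univ, smul_eq_mul, ENNReal.inv_mul_cancel us_pos us_fin]
  simp

theorem sph_ne : sphMeasure ≠ 0 := by
  intro h
  have : sphMeasure Set.univ = 1 := by
    rw [sphMeasure, Measure.smul_apply, Measure.restrict_apply_univ, smul_eq_mul, ENNReal.inv_mul_cancel us_pos us_fin]
  rw [h] at this
  simp at this

theorem sph_ae : ∀ᵐ I ∂sphMeasure, I ∈ USphere := by
  unfold sphMeasure
  exact Measure.ae_smul_measure (ae_restrict_mem us_meas) _

theorem pt_cont2 : Continuous (fun p : ℝ × Quaternion ℝ => ptOn p.2 p.1) := by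
  simp only [pt_eq]
  fun_prop

theorem sigma_exists {P : Quaternion ℝ → Prop} (h : ∀ᵐ q ∂SigmaBd, P q) :
    ∃ I ∈ USphere, ∀ᵐ t ∂(volume.restrict (Set.Ico 0 (2 * Real.pi))), P (ptOn I t) := by
  unfold SigmaBd at h
  have hc : (ENNReal.ofReal (2 * Real.pi))⁻¹ ≠ 0 := ENNReal.inv_ne_zero.2 ENNReal.ofReal_ne_top
  rw [ae_iff, Measure.smul_apply, smul_eq_mul, mul_eq_zero, or_iff_right hc, ← ae_iff] at h
  have h2 := ae_of_ae_map pt_cont2.measurable.aemeasurable h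
  rw [← Measure.prod_swap] at h2
  have h3 := ae_of_ae_map measurable_swap.aemeasurable h2
  have h4 := Measure.ae_ae_of_ae_prod h3
  haveI : NeZero sphMeasure := ⟨sph_ne⟩
  obtain ⟨I, hI, hI2⟩ := (sph_ae.and h4).exists
  exact ⟨I, hI, hI2⟩

theorem sphere_param {q : Quaternion ℝ} (hq : ‖q‖ = 1) : ∃ J ∈ USphere, q = ptOn J (Real.arccos q.re) := by
  have h := qnorm_sq q
  rw [hq] at h
  have h1 : -1 ≤ q.re := by nlinarith [sq_nonneg q.imI, sq_nonneg q.imJ, sq_nonneg q.imK]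
  have h2 : q.re ≤ 1 := by nlinarith [sq_nonneg q.imI, sq_nonneg q.imJ, sq_nonneg q.imK]
  set s := Real.sin (Real.arccos q.re) with hs
  have hs2 : s ^ 2 = q.imI ^ 2 + q.imJ ^ 2 + q.imK ^ 2 := by
    rw [hs, Real.sin_arccos, Real.sq_sqrt (by nlinarith)]; linarith
  by_cases h0 : s = 0
  · refine ⟨qi, qi_us, ?_⟩
    rw [h0] at hs2
    have a1 : q.imI = 0 := by nlinarith [sq_nonneg q.imI, sq_nonneg q.imJ, sq_nonneg q.imK]
    have a2 : q.imJ = 0 := by nlinarith [sq_nonneg q.imI, sq_nonneg q.imJ, sq_nonneg q.imK]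
    have a3 : q.imK = 0 := by nlinarith [sq_nonneg q.imI, sq_nonneg q.imJ, sq_nonneg q.imK]
    rw [ptOn, ← hs, h0, Real.cos_arccos h1 h2]
    ext <;> simp [a1, a2, a3]
  · refine ⟨s⁻¹ • q.im, us_of (by simp) ?_, ?_⟩
    · simp only [Quaternion.imI_smul, Quaternion.imJ_smul, Quaternion.imK_smul, Quaternion.imI_im,
        Quaternion.imJ_im, Quaternion.imK_im, smul_eq_mul]
      field_simp
      linarith
    · rw [ptOn, ← hs, Real.cos_arccos h1 h2, smul_smul, mul_inv_cancel₀ h0, one_smul]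
      simp

theorem sigma_of {P : Quaternion ℝ → Prop}
    (h : ∀ᵐ t ∂(volume.restrict (Set.Ico 0 (2 * Real.pi))), ∀ J ∈ USphere, P (ptOn J t)) :
    ∀ᵐ q ∂SigmaBd, P q := by
  rw [ae_restrict_iff' measurableSet_Ico] at h
  have hpi := Real.pi_pos
  obtain ⟨S, hS, hSm, hSae⟩ := (eventually_iff_exists_mem.1 h).elim (fun v hv =>
    show ∃ S : Set ℝ, (∀ t ∈ S, t ∈ Set.Ico 0 (2 * Real.pi) → ∀ J ∈ USphere, P (ptOn J t)) ∧
      MeasurableSet S ∧ ∀ᵐ t : ℝ, t ∈ S from by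
      refine ⟨(toMeasurable volume vᶜ)ᶜ, ?_, (measurableSet_toMeasurable _ _).compl, ?_⟩
      · intro t ht
        apply hv.2
        by_contra hh
        exact ht (subset_toMeasurable _ _ hh)
      · rw [ae_iff]
        simp only [Set.mem_compl_iff, not_not, Set.ofPred_mem_eq, measure_toMeasurable]
        exact hv.1)
  have h2 : ∀ᵐ t : ℝ, 2 * Real.pi - t ∈ S :=
    (Measure.measurePreserving_sub_left volume (2 * Real.pi)).quasiMeasurePreserving.ae hSae
  have h3 : ∀ᵐ t ∂(volume.restrict (Set.Ico 0 (2 * Real.pi))), Real.arccos (Real.cos t) ∈ S := by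
    rw [ae_restrict_iff' measurableSet_Ico]
    filter_upwards [hSae, h2] with t t1 t2 ht
    rcases le_total t Real.pi with hl | hl
    · rwa [Real.arccos_cos ht.1 hl]
    · rw [show Real.cos t = Real.cos (2 * Real.pi - t) by rw [Real.cos_two_pi_sub],
        Real.arccos_cos (by linarith [ht.2]) (by linarith)]
      exact t2
  unfold SigmaBd
  apply Measure.ae_smul_measure
  have hG : MeasurableSet {q : Quaternion ℝ | ‖q‖ = 1 ∧ Real.arccos q.re ∈ S} := by
    apply MeasurableSet.inter
    · exact (isClosed_eq continuous_norm continuous_const).measurableSet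
    · exact (Real.continuous_arccos.comp Quaternion.continuous_re).measurable hSm
  have hG2 : ∀ᵐ q ∂(Measure.map (fun p : ℝ × Quaternion ℝ => ptOn p.2 p.1)
      ((volume.restrict (Set.Ico 0 (2 * Real.pi))).prod sphMeasure)),
      ‖q‖ = 1 ∧ Real.arccos q.re ∈ S := by
    rw [ae_map_iff pt_cont2.measurable.aemeasurable hG]
    filter_upwards [Measure.quasiMeasurePreserving_fst.ae h3,
      Measure.quasiMeasurePreserving_snd.ae sph_ae] with p p1 p2
    refine ⟨pt_norm p2 _, ?_⟩
    have : (ptOn p.2 p.1).re = Real.cos p.1 := by simp [ptOn, (us_re p2).1]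
    rw [this]; exact p1
  filter_upwards [hG2] with q hq
  obtain ⟨J, hJ, he⟩ := sphere_param hq.1
  rw [he]
  exact hS _ hq.2 ⟨Real.arccos_nonneg _, by linarith [Real.arccos_le_pi q.re]⟩ J hJ


theorem EE_sum {a : ℕ → Quaternion ℝ} (ha : MemH2 a) (hE : EE a) : ∑' n, ‖a n‖ ^ 2 = 1 := by
  have := hE 0
  rw [SS_zero ha, if_pos rfl] at this
  have h2 := congrArg (fun q : Quaternion ℝ => q.re) this
  simpa using h2

theorem inner_iff_tilde_conj_eq_one (a : ℕ → Quaternion ℝ) (ha : MemH2 a) :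
    [ IsInnerQ a,
      ∀ᵐ q ∂SigmaBd, evalZ (convZ (tildeZ a) (conjZ a)) q = 1 ∧
        evalZ (convZ (conjZ a) (tildeZ a)) q = 1,
      ∃ I ∈ USphere, ∀ᵐ t ∂(volume.restrict (Set.Ico 0 (2 * Real.pi))),
        evalZ (convZ (tildeZ a) (conjZ a)) (ptOn I t) = 1 ∧
        evalZ (convZ (conjZ a) (tildeZ a)) (ptOn I t) = 1 ].TFAE := by
  tfae_have 1 → 2 := by
    intro h
    have hb : ∀ q ∈ QBall, ‖evalS a q‖ ≤ 1 := h.2.1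
    obtain ⟨I, hI, hae⟩ := sigma_exists h.2.2
    have hn := sum_eq_one ha hI hb hae
    have hE := EE_of_bound ha hb hn
    have hn2 : ∑' n, ‖conjS a n‖ ^ 2 = 1 := by
      simpa only [conjS, norm_star] using hn
    have hE2 := EE_of_bound (conjS_mem ha) (fun q hq => bound_conj ha hE hq) hn2
    rw [(EE_iff a).1 hE, (EE_conj_iff a).1 hE2]
    exact Eventually.of_forall fun q => ⟨evalZ_one q, evalZ_one q⟩
  tfae_have 2 → 3 := fun h => sigma_exists h
  tfae_have 3 → 1 := by
    rintro ⟨I, hI, h⟩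
    have hE := (EE_iff a).2 (evalZ_unique hI (h.mono fun t ht => ht.1))
    have hE2 := (EE_conj_iff a).2 (evalZ_unique hI (h.mono fun t ht => ht.2))
    have hb : ∀ q ∈ QBall, ‖evalS a q‖ ≤ 1 := by
      intro q hq
      have := bound_conj (conjS_mem ha) hE2 hq
      rwa [conjS_conjS] at this
    exact ⟨ha, hb, sigma_of (bd_all ha hb (EE_sum ha hE))⟩
  tfae_finish
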